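/- Suppose μ has an exponential local moment and Γ_μ is strongly irreducible and contracting, and let Z be a random variable on P(V) whose law is the unique μ-invariant probability measure ν on P(V). Then for every t ∈ (0,1): limsup_{n→∞} [ sup_H P( δ(Z, H) ≤ t^n ) ]^{1/n} < 1, where the supremum is over all projective hyperplanes H of P(V). -/

import Mathlib

open MeasureTheory ProbabilityTheory Filter Matrix
open scoped ENNReal

noncomputable section

/-- The absolute value of `k` is non-archimedean (ultrametric). -/
def IsNonarch (k : Type*) [NormedField k] : Prop := ∀ a b : k, ‖a + b‖ ≤ max ‖a‖ ‖b‖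

variable {k : Type*} [NontriviallyNormedField k] {d : ℕ}

open Classical in
/-- The canonical norm on `k^ι`: the Euclidean/Hermitian norm in the archimedean
case, the max norm in the non-archimedean case. -/
def vnorm {ι : Type*} [Fintype ι] (x : ι → k) : ℝ :=
  if IsNonarch k then ⨆ i, ‖x i‖ else Real.sqrt (∑ i, ‖x i‖ ^ 2)

/-- The operator norm on matrices induced by the canonical norm. -/
def mnorm {ι : Type*} [Fintype ι] (g : Matrix ι ι k) : ℝ :=
  sSup ((fun x => vnorm (g.mulVec x)) '' {x : ι → k | vnorm x = 1})

open Classical in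
/-- The norm of `x ∧ y` in `Λ² k^d`. -/
def wnorm (x y : Fin d → k) : ℝ :=
  if IsNonarch k then ⨆ p : Fin d × Fin d, ‖x p.1 * y p.2 - x p.2 * y p.1‖
  else Real.sqrt (∑ p : Fin d × Fin d,
    if p.1 < p.2 then ‖x p.1 * y p.2 - x p.2 * y p.1‖ ^ 2 else 0)

/-- The Fubini–Study distance between the directions of two nonzero vectors:
`δ([x],[y]) = ‖x ∧ y‖ / (‖x‖ ‖y‖)`. -/
def pdist (x y : Fin d → k) : ℝ := wnorm x y / (vnorm x * vnorm y)

/-- `δ([x], H)` where `H = ker f` and the linear form `f` has coordinate vector `c`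
in the dual basis; equals `|f x| / (‖f‖ ‖x‖)` (the dual norm of `f` being the
canonical norm of its coordinate vector `c`). -/
def pdistH (x c : Fin d → k) : ℝ := ‖∑ i, c i * x i‖ / (vnorm c * vnorm x)

/-- The special linear group `SL_d(k)`. -/
abbrev SLgp (d : ℕ) (k : Type*) [Field k] := Matrix.SpecialLinearGroup (Fin d) k

instance {m : Type*} [Fintype m] [MeasurableSpace k] : MeasurableSpace (Matrix m m k) :=
  inferInstanceAs (MeasurableSpace (m → m → k))
instance : TopologicalSpace (SLgp d k) :=
  inferInstanceAs (TopologicalSpace {A : Matrix (Fin d) (Fin d) k // A.det = 1})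
instance [MeasurableSpace k] : MeasurableSpace (SLgp d k) :=
  inferInstanceAs (MeasurableSpace {A : Matrix (Fin d) (Fin d) k // A.det = 1})
instance : TopologicalSpace (Projectivization k (Fin d → k)) :=
  instTopologicalSpaceQuotient
instance [MeasurableSpace k] : MeasurableSpace (Projectivization k (Fin d → k)) :=
  Quotient.instMeasurableSpace

lemma slInjective (g : SLgp d k) :
    Function.Injective ((g : Matrix (Fin d) (Fin d) k).mulVecLin) := by
  intro x y h
  simp only [Matrix.mulVecLin_apply] at h
  have h2 := congrArg (fun v => ((g⁻¹ : SLgp d k) : Matrix (Fin d) (Fin d) k).mulVec v) h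
  simpa [Matrix.mulVec_mulVec, Matrix.adjugate_mul,
    Matrix.SpecialLinearGroup.det_coe] using h2

lemma slTransposeInjective (g : SLgp d k) :
    Function.Injective (((g : Matrix (Fin d) (Fin d) k))ᵀ.mulVecLin) := by
  intro x y h
  simp only [Matrix.mulVecLin_apply] at h
  have h2 := congrArg
    (fun v => (((g⁻¹ : SLgp d k) : Matrix (Fin d) (Fin d) k))ᵀ.mulVec v) h
  simpa [Matrix.mulVec_mulVec, ← Matrix.transpose_mul, Matrix.mul_adjugate,
    Matrix.SpecialLinearGroup.det_coe] using h2

lemma sl_mulVec_ne_zero (g : SLgp d k) {x : Fin d → k} (hx : x ≠ 0) :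
    (g : Matrix (Fin d) (Fin d) k).mulVec x ≠ 0 := by
  intro h
  apply hx
  apply slInjective g
  simpa [Matrix.mulVecLin_apply] using h

/-- The action of `SL_d(k)` on the projective space `P(k^d)`. -/
def pact (g : SLgp d k) :
    Projectivization k (Fin d → k) → Projectivization k (Fin d → k) :=
  Projectivization.map ((g : Matrix (Fin d) (Fin d) k).mulVecLin) (slInjective g)

/-- The action of `SL_d(k)` on the projective space of the dual `P((k^d)^*)`,
where linear forms are identified with their coordinate vectors in the dual basis:
`g · f = f ∘ g⁻¹` corresponds to `c ↦ (g⁻¹)ᵀ c`. -/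
def pactDual (g : SLgp d k) :
    Projectivization k (Fin d → k) → Projectivization k (Fin d → k) :=
  Projectivization.map (((g⁻¹ : SLgp d k) : Matrix (Fin d) (Fin d) k))ᵀ.mulVecLin
    (slTransposeInjective g⁻¹)

/-- Fubini–Study distance on the projective space. -/
def pdelta (P Q : Projectivization k (Fin d → k)) : ℝ := pdist P.rep Q.rep

/-- Distance from a point of projective space to the projective hyperplane defined
by the linear form with coordinate vector `c`. -/
def pdeltaH (P : Projectivization k (Fin d → k)) (c : Fin d → k) : ℝ := pdistH P.rep c

/-- The topological support of a measure. -/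
def measSupport {G : Type*} [TopologicalSpace G] [MeasurableSpace G]
    (μ : Measure G) : Set G :=
  {g | ∀ U : Set G, IsOpen U → g ∈ U → μ U ≠ 0}

/-- The smallest closed subsemigroup containing a set. -/
def smallestClosedSemigroup {G : Type*} [TopologicalSpace G] [Mul G] (A : Set G) :
    Set G :=
  ⋂₀ {S : Set G | A ⊆ S ∧ IsClosed S ∧ ∀ a ∈ S, ∀ b ∈ S, a * b ∈ S}

/-- `Γ_μ`: the smallest closed subsemigroup containing the support of `μ`. -/
def GammaMu {G : Type*} [TopologicalSpace G] [MeasurableSpace G] [Mul G]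
    (μ : Measure G) : Set G :=
  smallestClosedSemigroup (measSupport μ)

/-- A set of matrices acts strongly irreducibly: no finite union of nonzero proper
subspaces is invariant. -/
def StronglyIrred (Γ : Set (SLgp d k)) : Prop :=
  ∀ F : Finset (Submodule k (Fin d → k)), F.Nonempty → (∀ W ∈ F, W ≠ ⊥ ∧ W ≠ ⊤) →
    ¬ (∀ g ∈ Γ, ∀ x : Fin d → k, (∃ W ∈ F, x ∈ W) →
        ∃ W' ∈ F, (g : Matrix (Fin d) (Fin d) k).mulVec x ∈ W')

/-- There are `γ_n ∈ Γ` and `r_n ∈ k` with `‖r_n γ_n‖ = 1` such that `r_n γ_n`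
converges to a rank `p` endomorphism. -/
def HasIndexSeq (Γ : Set (SLgp d k)) (p : ℕ) : Prop :=
  ∃ (γ : ℕ → SLgp d k) (r : ℕ → k) (A : Matrix (Fin d) (Fin d) k),
    (∀ n, γ n ∈ Γ) ∧
    (∀ n, mnorm (r n • ((γ n : Matrix (Fin d) (Fin d) k))) = 1) ∧
    Tendsto (fun n => r n • ((γ n : Matrix (Fin d) (Fin d) k))) atTop (nhds A) ∧
    A.rank = p

/-- `Γ` is contracting: some subsequence of some normalized sequence of `Γ`
converges to a rank-one endomorphism. -/
def ContractingSet (Γ : Set (SLgp d k)) : Prop :=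
  ∃ (γ : ℕ → SLgp d k) (r : ℕ → k) (φ : ℕ → ℕ) (A : Matrix (Fin d) (Fin d) k),
    (∀ n, γ n ∈ Γ) ∧
    (∀ n, mnorm (r n • ((γ n : Matrix (Fin d) (Fin d) k))) = 1) ∧
    StrictMono φ ∧
    Tendsto (fun n => r (φ n) • ((γ (φ n) : Matrix (Fin d) (Fin d) k))) atTop (nhds A) ∧
    A.rank = 1

/-- `μ` has an exponential (local) moment: `∫ ‖g‖^τ dμ(g) < ∞` for some `τ > 0`. -/
def ExpLocalMoment [MeasurableSpace k] (μ : Measure (SLgp d k)) : Prop :=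
  ∃ τ : ℝ, 0 < τ ∧
    ∫⁻ g, ENNReal.ofReal (mnorm ((g : Matrix (Fin d) (Fin d) k)) ^ τ) ∂μ < ⊤

/-- `ν` is invariant for the measure `m` and the action `act`:
`∫∫ φ(g·a) dm(g) dν(a) = ∫ φ dν` for all bounded Borel `φ`. -/
def InvariantMeasure {α G : Type*} [MeasurableSpace α] [MeasurableSpace G]
    (m : Measure G) (act : G → α → α) (ν : Measure α) : Prop :=
  ∀ φ : α → ℝ, Measurable φ → (∃ C, ∀ a, |φ a| ≤ C) →
    ∫ g, ∫ a, φ (act g a) ∂ν ∂m = ∫ a, φ a ∂ν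

/-- The right random walk `M_n = X_1 ⋯ X_n`. -/
def Mword {Ω G : Type*} [Monoid G] (X : ℕ → Ω → G) (n : ℕ) (ω : Ω) : G :=
  ((List.range n).map fun i => X (i + 1) ω).prod

/-- The left random walk `S_n = X_n ⋯ X_1`. -/
def Sword {Ω G : Type*} [Monoid G] (X : ℕ → Ω → G) (n : ℕ) (ω : Ω) : G :=
  ((List.range n).map fun i => X (n - i) ω).prod

/-- The second compound matrix: the matrix of the induced map on `Λ² k^d`,
whose entries are the `2 × 2` minors. -/
def comp2 (g : Matrix (Fin d) (Fin d) k) :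
    Matrix {p : Fin d × Fin d // p.1 < p.2} {p : Fin d × Fin d // p.1 < p.2} k :=
  Matrix.of fun p q =>
    g p.1.1 q.1.1 * g p.1.2 q.1.2 - g p.1.1 q.1.2 * g p.1.2 q.1.1

/-- The maximal compact group `K`: the elements of `SL_d(k)` acting by isometries of
the canonical norm (this is `SO_d(ℝ)`, `SU_d(ℂ)`, resp. `SL_d(O_k)`). -/
def Kiso (d : ℕ) (k : Type*) [NontriviallyNormedField k] : Set (SLgp d k) :=
  {g | ∀ x : Fin d → k, vnorm ((g : Matrix (Fin d) (Fin d) k).mulVec x) = vnorm x}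

end

set_option linter.unusedSectionVars false

namespace WR

section Abstract

variable {G : Type*} [Monoid G] [MeasurableSpace G]

/-- The Markov operator of the right random walk. -/
noncomputable def Pop (μ : Measure G) (f : G → ℝ≥0∞) (g : G) : ℝ≥0∞ := ∫⁻ h, f (g * h) ∂μ

/-- Iterates of the Markov operator. -/
noncomputable def It (μ : Measure G) : ℕ → (G → ℝ≥0∞) → G → ℝ≥0∞
  | 0, f => f
  | n + 1, f => Pop μ (It μ n f)

open Classical in
/-- Expected reward at the first hitting time of `A` before time `n`. -/
noncomputable def Rew (μ : Measure G) (A : Set G) (f : G → ℝ≥0∞) : ℕ → G → ℝ≥0∞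
  | 0 => fun g => if g ∈ A then f g else 0
  | n + 1 => fun g => if g ∈ A then f g else Pop μ (Rew μ A f n) g

open Classical in
/-- Probability of not hitting `A` before time `n`. -/
noncomputable def Sv (μ : Measure G) (A : Set G) : ℕ → G → ℝ≥0∞
  | 0 => fun g => if g ∈ A then 0 else 1
  | n + 1 => fun g => if g ∈ A then 0 else Pop μ (Sv μ A n) g

open Classical in
/-- Indicator. -/
noncomputable def ind (A : Set G) (g : G) : ℝ≥0∞ := if g ∈ A then 1 else 0

variable (μ : Measure G)

lemma Pop_mono {f f' : G → ℝ≥0∞} (h : ∀ g, f g ≤ f' g) (g : G) : Pop μ f g ≤ Pop μ f' g :=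
  lintegral_mono fun _ => h _

lemma Pop_const [IsProbabilityMeasure μ] (a : ℝ≥0∞) (g : G) : Pop μ (fun _ => a) g = a := by
  simp [Pop]

lemma Pop_const_mul (f : G → ℝ≥0∞) (a : ℝ≥0∞) (ha : a ≠ ⊤) (g : G) :
    Pop μ (fun x => a * f x) g = a * Pop μ f g :=
  lintegral_const_mul' _ _ ha

lemma It_mono {f f' : G → ℝ≥0∞} (h : ∀ g, f g ≤ f' g) (n : ℕ) (g : G) :
    It μ n f g ≤ It μ n f' g := by
  induction n generalizing g with
  | zero => exact h g
  | succ n ih => exact Pop_mono μ ih g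

lemma It_const [IsProbabilityMeasure μ] (a : ℝ≥0∞) (n : ℕ) (g : G) :
    It μ n (fun _ => a) g = a := by
  induction n generalizing g with
  | zero => rfl
  | succ n ih =>
    have : It μ n (fun _ => a) = fun _ => a := funext ih
    simp only [It, this, Pop_const]

lemma It_const_mul (f : G → ℝ≥0∞) (a : ℝ≥0∞) (ha : a ≠ ⊤) (n : ℕ) (g : G) :
    It μ n (fun x => a * f x) g = a * It μ n f g := by
  induction n generalizing g with
  | zero => rfl
  | succ n ih =>
    have : It μ n (fun x => a * f x) = fun x => a * It μ n f x := funext ih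
    simp only [It, this, Pop_const_mul μ _ a ha]

lemma It_translate (f : G → ℝ≥0∞) (a : G) (n : ℕ) (g : G) :
    It μ n (fun x => f (a * x)) g = It μ n f (a * g) := by
  induction n generalizing g with
  | zero => rfl
  | succ n ih =>
    have : It μ n (fun x => f (a * x)) = fun x => It μ n f (a * x) := funext ih
    simp only [It, this, Pop, mul_assoc]

lemma It_add_time (f : G → ℝ≥0∞) (n m : ℕ) : It μ (n + m) f = It μ n (It μ m f) := by
  induction n with
  | zero => simp [It]
  | succ n ih => rw [Nat.succ_add]; simp only [It, ih]

lemma It_succ' (f : G → ℝ≥0∞) (n : ℕ) : It μ (n + 1) f = It μ n (Pop μ f) := by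
  rw [It_add_time]; rfl

lemma measurable_ind {A : Set G} (hA : MeasurableSet A) : Measurable (ind A) :=
  Measurable.ite hA measurable_const measurable_const

lemma ind_le_one (A : Set G) (g : G) : ind A g ≤ 1 := by
  unfold ind; split_ifs <;> simp

lemma It_le_const [IsProbabilityMeasure μ] {f : G → ℝ≥0∞} {a : ℝ≥0∞} (h : ∀ g, f g ≤ a)
    (n : ℕ) (g : G) : It μ n f g ≤ a :=
  (It_mono μ h n g).trans (It_const μ a n g).le

variable [MeasurableMul₂ G] [IsProbabilityMeasure μ]

lemma measurable_Pop {f : G → ℝ≥0∞} (hf : Measurable f) : Measurable (Pop μ f) := by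
  have : Measurable (fun p : G × G => f (p.1 * p.2)) :=
    hf.comp measurable_mul
  exact this.lintegral_prod_right'

lemma measurable_It {f : G → ℝ≥0∞} (hf : Measurable f) (n : ℕ) : Measurable (It μ n f) := by
  induction n with
  | zero => exact hf
  | succ n ih => exact measurable_Pop μ ih

lemma measurable_Rew {A : Set G} (hA : MeasurableSet A) {f : G → ℝ≥0∞} (hf : Measurable f)
    (n : ℕ) : Measurable (Rew μ A f n) := by
  induction n with
  | zero => exact Measurable.ite hA hf measurable_const
  | succ n ih => exact Measurable.ite hA hf (measurable_Pop μ ih)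

lemma Pop_add {f f' : G → ℝ≥0∞} (hf : Measurable f) (g : G) :
    Pop μ (fun x => f x + f' x) g = Pop μ f g + Pop μ f' g :=
  lintegral_add_left (hf.comp (measurable_const_mul g)) _

lemma It_add {f f' : G → ℝ≥0∞} (hf : Measurable f) (n : ℕ) (g : G) :
    It μ n (fun x => f x + f' x) g = It μ n f g + It μ n f' g := by
  induction n generalizing g with
  | zero => rfl
  | succ n ih =>
    have : It μ n (fun x => f x + f' x) = fun x => It μ n f x + It μ n f' x := funext ih
    simp only [It, this, Pop_add μ (measurable_It μ hf n)]

lemma Pop_sum {ι : Type*} (s : Finset ι) {f : ι → G → ℝ≥0∞} (hf : ∀ i, Measurable (f i)) (g : G) :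
    Pop μ (fun x => ∑ i ∈ s, f i x) g = ∑ i ∈ s, Pop μ (f i) g :=
  lintegral_finsetSum _ fun i _ => (hf i).comp (measurable_const_mul g)

lemma It_sum {ι : Type*} (s : Finset ι) {f : ι → G → ℝ≥0∞} (hf : ∀ i, Measurable (f i)) (n : ℕ)
    (g : G) : It μ n (fun x => ∑ i ∈ s, f i x) g = ∑ i ∈ s, It μ n (f i) g := by
  induction n generalizing g with
  | zero => rfl
  | succ n ih =>
    have : It μ n (fun x => ∑ i ∈ s, f i x) = fun x => ∑ i ∈ s, It μ n (f i) x := funext ih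
    simp only [It, this, Pop_sum μ s (fun i => measurable_It μ (hf i) n)]

lemma It_tsum {f : ℕ → G → ℝ≥0∞} (hf : ∀ i, Measurable (f i)) (n : ℕ)
    (g : G) : It μ n (fun x => ∑' i, f i x) g = ∑' i, It μ n (f i) g := by
  induction n generalizing g with
  | zero => rfl
  | succ n ih =>
    have : It μ n (fun x => ∑' i, f i x) = fun x => ∑' i, It μ n (f i) x := funext ih
    simp only [It, this]
    exact lintegral_tsum fun i => ((measurable_It μ (hf i) n).comp (measurable_const_mul g)).aemeasurable

lemma max_ineq {A : Set G} {F : G → ℝ≥0∞} (hF : ∀ g, Pop μ F g ≤ F g) (a : ℝ≥0∞) (ha : a ≠ ⊤)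
    (h1 : ∀ g ∈ A, 1 ≤ a * F g) (n : ℕ) (g : G) : Rew μ A (fun _ => 1) n g ≤ a * F g := by
  induction n generalizing g with
  | zero =>
    unfold Rew; split_ifs with h
    · exact h1 g h
    · exact zero_le
  | succ n ih =>
    unfold Rew; split_ifs with h
    · exact h1 g h
    · calc _ ≤ Pop μ (fun x => a * F x) g := Pop_mono μ ih g
        _ = a * Pop μ F g := Pop_const_mul μ _ _ ha _
        _ ≤ _ := by gcongr; exact hF g

lemma It_ind_le_hit (A : Set G) (n : ℕ) (g : G) :
    It μ n (ind A) g ≤ Rew μ A (fun _ => 1) n g := by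
  induction n generalizing g with
  | zero => exact le_rfl
  | succ n ih =>
    unfold Rew; split_ifs with h
    · exact It_le_const μ (ind_le_one A) _ _
    · exact Pop_mono μ ih g

lemma hit_le_one (A : Set G) (n : ℕ) (g : G) :
    Rew μ A (fun _ => 1) n g ≤ 1 := by
  induction n generalizing g with
  | zero => unfold Rew; split_ifs <;> simp
  | succ n ih =>
    unfold Rew; split_ifs with h
    · exact le_rfl
    · exact (Pop_mono μ ih g).trans (Pop_const μ 1 g).le

lemma hit_translate {E A : Set G} (a : G) (h : ∀ x, a * x ∈ E → x ∈ A) (n : ℕ) (g : G) :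
    Rew μ E (fun _ => 1) n (a * g) ≤ Rew μ A (fun _ => 1) n g := by
  induction n generalizing g with
  | zero =>
    unfold Rew; split_ifs with h1 h2 h2
    · exact le_rfl
    · exact absurd (h _ h1) h2
    · exact zero_le
    · exact le_rfl
  | succ n ih =>
    by_cases h2 : g ∈ A
    · exact (hit_le_one μ E _ _).trans (by simp [Rew, h2])
    · have h1 : a * g ∉ E := fun h1 => h2 (h _ h1)
      simp only [Rew, h1, h2, if_false, Pop, mul_assoc]
      exact lintegral_mono fun x => ih _

/-- Green function. -/
noncomputable def Gr (μ : Measure G) (E : Set G) (n : ℕ) (g : G) : ℝ≥0∞ :=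
  ∑ m ∈ Finset.range n, It μ m (ind E) g

lemma Gr_succ {E : Set G} (hE : MeasurableSet E) (n : ℕ) (g : G) :
    Gr μ E (n + 1) g = ind E g + Pop μ (Gr μ E n) g := by
  unfold Gr
  rw [Finset.sum_range_succ']
  have := Pop_sum μ (Finset.range n) (f := fun m => It μ m (ind E))
    (fun m => measurable_It μ (measurable_ind hE) m) g
  rw [this, add_comm]; rfl

lemma green_bound {E : Set G} (hE : MeasurableSet E) (n0 : ℕ)
    (hE2 : ∀ g ∈ E, ∀ n, It μ n0 (Rew μ E (fun _ => 1) n) g ≤ 1 / 2) (n : ℕ) (g : G) :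
    Gr μ E n g ≤ 2 * n0 := by
  set S : ℝ≥0∞ := ⨆ g ∈ E, Gr μ E n g with hS
  have hle : ∀ g, Gr μ E n g ≤ n := by
    intro g
    unfold Gr
    calc _ ≤ ∑ m ∈ Finset.range n, (1 : ℝ≥0∞) :=
          Finset.sum_le_sum fun m _ => It_le_const μ (ind_le_one E) m g
      _ = n := by simp
  have hSn : S ≤ n := iSup₂_le fun g _ => hle g
  have hSt : S ≠ ⊤ := ne_top_of_le_ne_top (ENNReal.natCast_ne_top n) hSn
  have key : ∀ m ≤ n, ∀ g, Gr μ E m g ≤ S * Rew μ E (fun _ => 1) m g := by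
    intro m
    induction m with
    | zero => intro _ g; simp [Gr]
    | succ m ih =>
      intro hm g
      by_cases hg : g ∈ E
      · simp only [Rew, hg, if_true, mul_one]
        calc Gr μ E (m+1) g ≤ Gr μ E n g := by
              unfold Gr
              exact Finset.sum_le_sum_of_subset (Finset.range_mono hm)
          _ ≤ S := le_iSup₂ (f := fun g (_ : g ∈ E) => Gr μ E n g) g hg
      · rw [Gr_succ μ hE]
        simp only [Rew, hg, if_false, ind, zero_add]
        rw [← Pop_const_mul μ _ _ hSt]
        exact Pop_mono μ (ih (by omega)) g
  have hS2 : S ≤ n0 + S / 2 := by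
    refine iSup₂_le fun g hg => ?_
    calc Gr μ E n g ≤ ∑ m ∈ Finset.range (n0 + n), It μ m (ind E) g := by
          unfold Gr
          exact Finset.sum_le_sum_of_subset (Finset.range_mono (by omega))
      _ = ∑ m ∈ Finset.range n0, It μ m (ind E) g
            + ∑ m ∈ Finset.range n, It μ (n0 + m) (ind E) g := by
          rw [Finset.sum_range_add]
      _ ≤ n0 + It μ n0 (Gr μ E n) g := by
          gcongr
          · calc _ ≤ ∑ m ∈ Finset.range n0, (1 : ℝ≥0∞) :=
                  Finset.sum_le_sum fun m _ => It_le_const μ (ind_le_one E) m g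
              _ = n0 := by simp
          · have := It_sum μ (Finset.range n) (f := fun m => It μ m (ind E))
              (fun m => measurable_It μ (measurable_ind hE) m) n0 g
            simp only [It_add_time]
            exact this.symm.le
      _ ≤ n0 + S * (1/2) := by
          gcongr
          calc _ ≤ It μ n0 (fun x => S * Rew μ E (fun _ => 1) n x) g :=
                It_mono μ (key n le_rfl) n0 g
            _ = S * It μ n0 (Rew μ E (fun _ => 1) n) g := It_const_mul μ _ _ hSt _ _
            _ ≤ _ := by gcongr; exact hE2 g hg n
      _ = _ := by rw [mul_one_div]
  have hS3 : S ≤ 2 * n0 := by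
    clear_value S
    lift S to NNReal using hSt
    have h3 : (S : ℝ≥0∞) ≤ ((n0 + S / 2 : NNReal) : ℝ≥0∞) := by
      push_cast
      exact hS2
    have h4 : S ≤ n0 + S / 2 := by exact_mod_cast h3
    have h5 : S ≤ 2 * n0 := by
      have : (S : ℝ) ≤ n0 + S / 2 := by exact_mod_cast h4
      have : (S : ℝ) ≤ 2 * n0 := by linarith
      exact_mod_cast this
    exact_mod_cast h5
  calc Gr μ E n g ≤ S * Rew μ E (fun _ => 1) n g := key n le_rfl g
    _ ≤ S * 1 := by gcongr; exact hit_le_one μ E n g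
    _ ≤ _ := by rw [mul_one]; exact hS3

lemma Sv_le (A : Set G) (n : ℕ) (g : G) : Sv μ A n g ≤ It μ n (ind Aᶜ) g := by
  induction n generalizing g with
  | zero => unfold Sv It ind; split_ifs <;> simp_all
  | succ n ih =>
    unfold Sv; split_ifs with h
    · exact zero_le
    · exact Pop_mono μ ih g

lemma Sv_le_one (A : Set G) (n : ℕ) (g : G) : Sv μ A n g ≤ 1 :=
  (Sv_le μ A n g).trans (It_le_const μ (ind_le_one _) _ _)

lemma Sv_anti (A : Set G) (n : ℕ) (g : G) : Sv μ A (n + 1) g ≤ Sv μ A n g := by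
  induction n generalizing g with
  | zero =>
    by_cases h : g ∈ A
    · simp [Sv, h]
    · exact (Sv_le_one μ A _ g).trans (by simp [Sv, h])
  | succ n ih =>
    by_cases h : g ∈ A
    · simp [Sv, h]
    · have := Pop_mono μ ih g
      simpa [Sv, h] using this

lemma Sv_antitone (A : Set G) (g : G) : Antitone (fun n => Sv μ A n g) :=
  antitone_nat_of_succ_le fun n => Sv_anti μ A n g

lemma Sv_step (A : Set G) (L : ℕ) (q : ℝ≥0∞) (hq : q ≠ ⊤) (h : ∀ g, Sv μ A L g ≤ q) (n : ℕ) (g : G) :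
    Sv μ A (L + n) g ≤ q * Sv μ A n g := by
  induction n generalizing g with
  | zero =>
    by_cases hg : g ∈ A
    · cases L <;> simp [Sv, hg]
    · simpa [Sv, hg] using h g
  | succ n ih =>
    by_cases hg : g ∈ A
    · rw [← add_assoc]; simp [Sv, hg]
    · rw [← add_assoc]
      simp only [Sv, hg, if_false]
      rw [← Pop_const_mul μ _ _ hq]
      exact Pop_mono μ ih g

lemma Sv_pow (A : Set G) (L : ℕ) (q : ℝ≥0∞) (hq : q ≠ ⊤) (h : ∀ g, Sv μ A L g ≤ q) (j : ℕ) (g : G) :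
    Sv μ A (L * j) g ≤ q ^ j := by
  induction j with
  | zero => simpa using Sv_le_one μ A 0 g
  | succ j ih =>
    rw [Nat.mul_succ, add_comm, pow_succ']
    exact (Sv_step μ A L q hq h _ g).trans (by gcongr)

/-- After hitting `A`, the set `B` is visited with probability at most `a`. -/
lemma It_le_Sv {A B : Set G} {a : ℝ≥0∞} (hA : MeasurableSet A) (h : ∀ g ∈ A, ∀ n, It μ n (ind B) g ≤ a) (n : ℕ)
    (g : G) : It μ n (ind B) g ≤ Sv μ A n g + a := by
  have hm : ∀ n, Measurable (Sv μ A n) := by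
    intro n
    induction n with
    | zero => exact Measurable.ite hA measurable_const measurable_const
    | succ n ih => exact Measurable.ite hA measurable_const (measurable_Pop μ ih)
  induction n generalizing g with
  | zero =>
    by_cases hg : g ∈ A
    · exact (h g hg 0).trans le_add_self
    · exact (ind_le_one B g).trans (by simp [Sv, hg])
  | succ n ih =>
    by_cases hg : g ∈ A
    · exact (h g hg _).trans le_add_self
    · simp only [Sv, hg, if_false]
      calc It μ (n+1) (ind B) g ≤ Pop μ (fun x => Sv μ A n x + a) g := Pop_mono μ ih g
        _ = _ := by rw [Pop_add μ (hm n), Pop_const]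

/-- Overshoot estimate. -/
lemma Rew_overshoot {A : Set G} {f f1 w : G → ℝ≥0∞} {b K : ℝ≥0∞} (hK : K ≠ ⊤)
    (hw : Measurable w) (hf1m : Measurable f1)
    (hA : ∀ g ∈ A, f g ≤ b + f1 g) (h1 : ∀ g ∉ A, Pop μ f1 g ≤ K * w g) (n : ℕ) (g : G) :
    Rew μ A f n g ≤ b + f1 g + K * ∑ m ∈ Finset.range n, It μ m w g := by
  induction n generalizing g with
  | zero =>
    by_cases hg : g ∈ A
    · simpa [Rew, hg] using hA g hg
    · simp [Rew, hg]
  | succ n ih =>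
    by_cases hg : g ∈ A
    · simp only [Rew, hg, if_true]
      exact (hA g hg).trans le_self_add
    · simp only [Rew, hg, if_false]
      calc Pop μ (Rew μ A f n) g
          ≤ Pop μ (fun x => (b + f1 x) + K * ∑ m ∈ Finset.range n, It μ m w x) g := Pop_mono μ ih g
        _ = b + Pop μ f1 g + K * ∑ m ∈ Finset.range n, It μ (m+1) w g := by
          rw [Pop_add μ (f := fun x => b + f1 x) (measurable_const.add hf1m), Pop_add μ measurable_const, Pop_const,
            Pop_const_mul μ _ _ hK, Pop_sum μ _ (fun m => measurable_It μ hw m)]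
          rfl
        _ ≤ b + K * w g + K * ∑ m ∈ Finset.range n, It μ (m+1) w g := by
          gcongr; exact h1 g hg
        _ = b + K * ∑ m ∈ Finset.range (n+1), It μ m w g := by
          rw [Finset.sum_range_succ', mul_add, add_assoc, add_comm (K * w g)]; rfl
        _ ≤ _ := by gcongr; exact le_self_add

/-- Decomposition at the first hitting time. -/
lemma It_le_Rew {A : Set G} {f : G → ℝ≥0∞} {b a : ℝ≥0∞} (n : ℕ) (ha : a ≠ ⊤)
    (hA : ∀ g ∈ A, ∀ m ≤ n, It μ m f g ≤ a * f g) (hAc : ∀ g ∉ A, f g ≤ b) (g : G) :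
    It μ n f g ≤ b + a * Rew μ A f n g := by
  induction n generalizing g with
  | zero =>
    by_cases hg : g ∈ A
    · simpa [Rew, hg] using (hA g hg 0 le_rfl).trans le_add_self
    · exact (hAc g hg).trans le_self_add
  | succ n ih =>
    by_cases hg : g ∈ A
    · simpa [Rew, hg] using (hA g hg _ le_rfl).trans le_add_self
    · simp only [Rew, hg, if_false]
      calc It μ (n+1) f g ≤ Pop μ (fun x => b + a * Rew μ A f n x) g :=
            Pop_mono μ (ih fun g hg m hm => hA g hg m (by omega)) g
        _ = _ := by rw [Pop_add μ measurable_const, Pop_const, Pop_const_mul μ _ _ ha]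

lemma It_growth {f : G → ℝ≥0∞} {K : ℝ≥0∞} (hK : K ≠ ⊤) (h : ∀ g, Pop μ f g ≤ K * f g) (n : ℕ) (g : G) :
    It μ n f g ≤ K ^ n * f g := by
  induction n generalizing g with
  | zero => simp [It]
  | succ n ih =>
    calc It μ (n+1) f g ≤ Pop μ (fun x => K ^ n * f x) g := Pop_mono μ ih g
      _ = K ^ n * Pop μ f g := Pop_const_mul μ _ _ (ENNReal.pow_ne_top hK) _
      _ ≤ K ^ n * (K * f g) := by gcongr; exact h g
      _ = _ := by rw [pow_succ, mul_assoc]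

/-- Interpolation of rewards. -/
lemma Rew_interp {A : Set G} (hAm : MeasurableSet A) {f f' : G → ℝ≥0∞} {J e : ℝ≥0∞} (hJ : J ≠ ⊤)
    (he : e ≠ ⊤)
    (h : ∀ g, f g ≤ J * 1 + e * f' g) (n : ℕ) (g : G) :
    Rew μ A f n g ≤ J * Rew μ A (fun _ => 1) n g + e * Rew μ A f' n g := by
  induction n generalizing g with
  | zero =>
    by_cases hg : g ∈ A
    · simpa [Rew, hg] using h g
    · simp [Rew, hg]
  | succ n ih =>
    by_cases hg : g ∈ A
    · simpa [Rew, hg] using h g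
    · simp only [Rew, hg, if_false]
      calc _ ≤ Pop μ (fun x => J * Rew μ A (fun _ => 1) n x + e * Rew μ A f' n x) g :=
            Pop_mono μ ih g
        _ = _ := by
          rw [Pop_add μ ((measurable_Rew μ hAm measurable_const n).const_mul J),
            Pop_const_mul μ _ _ hJ, Pop_const_mul μ _ _ he]

end Abstract
end WR

set_option linter.unusedSectionVars false
namespace WR
section Norms
variable {k : Type*} [NontriviallyNormedField k] {d : ℕ}

/-- Sup norm of the entries. -/
noncomputable def nm (g : Matrix (Fin d) (Fin d) k) : ℝ := ‖fun p : Fin d × Fin d => g p.1 p.2‖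

/-- Sup norm of the two by two minors. -/
noncomputable def m2 (g : Matrix (Fin d) (Fin d) k) : ℝ :=
  ‖fun p : (Fin d × Fin d) × (Fin d × Fin d) =>
    g p.1.1 p.2.1 * g p.1.2 p.2.2 - g p.1.1 p.2.2 * g p.1.2 p.2.1‖

lemma nm_nonneg (g : Matrix (Fin d) (Fin d) k) : 0 ≤ nm g := norm_nonneg _
lemma m2_nonneg (g : Matrix (Fin d) (Fin d) k) : 0 ≤ m2 g := norm_nonneg _

lemma entry_le (g : Matrix (Fin d) (Fin d) k) (i j : Fin d) : ‖g i j‖ ≤ nm g :=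
  norm_le_pi_norm (fun p : Fin d × Fin d => g p.1 p.2) (i, j)

lemma nm_le {g : Matrix (Fin d) (Fin d) k} {r : ℝ} (hr : 0 ≤ r) (h : ∀ i j, ‖g i j‖ ≤ r) :
    nm g ≤ r := (pi_norm_le_iff_of_nonneg hr).2 fun p => h p.1 p.2

lemma minor_le (g : Matrix (Fin d) (Fin d) k) (i l j m : Fin d) :
    ‖g i j * g l m - g i m * g l j‖ ≤ m2 g :=
  norm_le_pi_norm (fun p : (Fin d × Fin d) × (Fin d × Fin d) =>
    g p.1.1 p.2.1 * g p.1.2 p.2.2 - g p.1.1 p.2.2 * g p.1.2 p.2.1) ((i, l), (j, m))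

lemma m2_le_of {g : Matrix (Fin d) (Fin d) k} {r : ℝ} (hr : 0 ≤ r)
    (h : ∀ i l j m, ‖g i j * g l m - g i m * g l j‖ ≤ r) :
    m2 g ≤ r := (pi_norm_le_iff_of_nonneg hr).2 fun p => h p.1.1 p.1.2 p.2.1 p.2.2

lemma exists_coord {ι : Type*} [Fintype ι] [Nonempty ι] (x : ι → k) : ∃ i, ‖x i‖ = ‖x‖ := by
  obtain ⟨i, hi⟩ := Finite.exists_max (fun i => ‖x i‖)
  exact ⟨i, le_antisymm (norm_le_pi_norm x i)
    ((pi_norm_le_iff_of_nonneg (norm_nonneg _)).2 hi)⟩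

lemma exists_entry [NeZero d] (g : Matrix (Fin d) (Fin d) k) : ∃ i j, ‖g i j‖ = nm g := by
  obtain ⟨p, hp⟩ := exists_coord (fun p : Fin d × Fin d => g p.1 p.2)
  exact ⟨p.1, p.2, hp⟩

lemma row_norm_le (g : Matrix (Fin d) (Fin d) k) (i : Fin d) : ‖g i‖ ≤ nm g :=
  (pi_norm_le_iff_of_nonneg (nm_nonneg g)).2 fun j => entry_le g i j

lemma exists_row [NeZero d] (g : Matrix (Fin d) (Fin d) k) : ∃ i, ‖g i‖ = nm g := by
  obtain ⟨i, j, h⟩ := exists_entry g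
  exact ⟨i, le_antisymm (row_norm_le g i) (h ▸ norm_le_pi_norm (g i) j)⟩

lemma norm_sum_le_card (f : Fin d → k) {r : ℝ} (h : ∀ i, ‖f i‖ ≤ r) : ‖∑ i, f i‖ ≤ d * r := by
  have := norm_sum_le_of_le Finset.univ (fun i _ => h i)
  simpa using this

lemma dot_le (c x : Fin d → k) : ‖c ⬝ᵥ x‖ ≤ d * (‖c‖ * ‖x‖) := by
  refine norm_sum_le_card _ fun i => ?_
  rw [norm_mul]
  exact mul_le_mul (norm_le_pi_norm c i) (norm_le_pi_norm x i) (norm_nonneg _) (norm_nonneg _)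

lemma mulVec_le (g : Matrix (Fin d) (Fin d) k) (x : Fin d → k) :
    ‖g *ᵥ x‖ ≤ d * (nm g * ‖x‖) := by
  refine (pi_norm_le_iff_of_nonneg (by have := nm_nonneg g; positivity)).2 fun i => ?_
  refine (dot_le (g i) x).trans ?_
  gcongr
  exact row_norm_le g i

lemma col_norm_le (g : Matrix (Fin d) (Fin d) k) (j : Fin d) : ‖(fun i => g i j)‖ ≤ nm g :=
  (pi_norm_le_iff_of_nonneg (nm_nonneg g)).2 fun i => entry_le g i j

lemma vecMul_le (g : Matrix (Fin d) (Fin d) k) (c : Fin d → k) :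
    ‖c ᵥ* g‖ ≤ d * (‖c‖ * nm g) := by
  refine (pi_norm_le_iff_of_nonneg (by have := nm_nonneg g; positivity)).2 fun j => ?_
  refine (dot_le c (fun i => g i j)).trans ?_
  gcongr
  exact col_norm_le g j

lemma nm_mul (g h : Matrix (Fin d) (Fin d) k) : nm (g * h) ≤ d * (nm g * nm h) := by
  have h1 := nm_nonneg g
  have h2 := nm_nonneg h
  refine nm_le (by positivity) fun i j => ?_
  rw [Matrix.mul_apply']
  refine (dot_le _ _).trans ?_
  gcongr
  · exact row_norm_le g i
  · exact col_norm_le h j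

lemma row_vecMul_le (g h : Matrix (Fin d) (Fin d) k) (i : Fin d) :
    ‖(g i) ᵥ* h‖ ≤ nm (g * h) :=
  row_norm_le (g * h) i

lemma m2_le (g : Matrix (Fin d) (Fin d) k) : m2 g ≤ 2 * nm g ^ 2 := by
  refine m2_le_of (by positivity) fun i l j m => ?_
  refine (norm_sub_le _ _).trans ?_
  rw [norm_mul, norm_mul]
  have := mul_le_mul (entry_le g i j) (entry_le g l m) (norm_nonneg _) (nm_nonneg g)
  have := mul_le_mul (entry_le g i m) (entry_le g l j) (norm_nonneg _) (nm_nonneg g)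
  nlinarith

lemma antisymm_sum (a m : Fin d → Fin d → k) (h0 : ∀ p, m p p = 0) (h1 : ∀ p q, m q p = - m p q) :
    ∑ p, ∑ q, a p q * m p q = ∑ p, ∑ q, if p < q then (a p q - a q p) * m p q else 0 := by
  have e1 : ∀ p q, a p q * m p q = (if p < q then a p q * m p q else 0)
      + (if q < p then a p q * m p q else 0) := by
    intro p q
    rcases lt_trichotomy p q with h | h | h
    · simp [h, h.not_gt]
    · subst h; simp [h0]
    · simp [h, h.not_gt]
  have e2 : ∑ p, ∑ q, (if q < p then a p q * m p q else 0)
      = ∑ p, ∑ q, (if p < q then - (a q p * m p q) else 0) := by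
    rw [Finset.sum_comm]
    refine Finset.sum_congr rfl fun p _ => Finset.sum_congr rfl fun q _ => ?_
    split_ifs
    · rw [h1 p q]; ring
    · rfl
  calc _ = ∑ p, ∑ q, (if p < q then a p q * m p q else 0)
      + ∑ p, ∑ q, (if q < p then a p q * m p q else 0) := by
        rw [← Finset.sum_add_distrib]
        refine Finset.sum_congr rfl fun p _ => ?_
        rw [← Finset.sum_add_distrib]
        exact Finset.sum_congr rfl fun q _ => e1 p q
    _ = _ := by
        rw [e2, ← Finset.sum_add_distrib]
        refine Finset.sum_congr rfl fun p _ => ?_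
        rw [← Finset.sum_add_distrib]
        refine Finset.sum_congr rfl fun q _ => ?_
        split_ifs <;> ring

lemma m2_mul (g h : Matrix (Fin d) (Fin d) k) : m2 (g * h) ≤ d * (d * (m2 g * m2 h)) := by
  have h1 := m2_nonneg g
  have h2 := m2_nonneg h
  refine m2_le_of (by positivity) fun i l j m => ?_
  have e : (g * h) i j * (g * h) l m - (g * h) i m * (g * h) l j
      = ∑ p, ∑ q, (g i p * g l q) * (h p j * h q m - h p m * h q j) := by
    simp only [Matrix.mul_apply, Finset.sum_mul_sum, ← Finset.sum_sub_distrib]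
    refine Finset.sum_congr rfl fun p _ => Finset.sum_congr rfl fun q _ => ?_
    ring
  rw [e, antisymm_sum (fun p q => g i p * g l q) (fun p q => h p j * h q m - h p m * h q j)
    (fun p => by ring) (fun p q => by ring)]
  refine norm_sum_le_card _ fun p => norm_sum_le_card _ fun q => ?_
  split_ifs
  · rw [norm_mul]
    exact mul_le_mul (minor_le g i l p q) (minor_le h p q j m) (norm_nonneg _) h1
  · simp; positivity

lemma cross_le (g : Matrix (Fin d) (Fin d) k) (c x y : Fin d → k) (l : Fin d) :
    ‖(c ⬝ᵥ (g *ᵥ x)) * (g *ᵥ y) l - (c ⬝ᵥ (g *ᵥ y)) * (g *ᵥ x) l‖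
      ≤ d ^ 3 * (‖c‖ * m2 g * ‖x‖ * ‖y‖) := by
  have e : (c ⬝ᵥ (g *ᵥ x)) * (g *ᵥ y) l - (c ⬝ᵥ (g *ᵥ y)) * (g *ᵥ x) l
      = ∑ m, ∑ p, ∑ q, c m * (g m p * g l q - g m q * g l p) * x p * y q := by
    simp only [dotProduct, mulVec, Finset.sum_mul, ← Finset.sum_sub_distrib]
    refine Finset.sum_congr rfl fun m _ => ?_
    have a1 : c m * (∑ p, g m p * x p) * (∑ q, g l q * y q)
        = ∑ p, ∑ q, c m * (g m p * g l q) * x p * y q := by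
      rw [mul_assoc, Finset.sum_mul_sum, Finset.mul_sum]
      refine Finset.sum_congr rfl fun p _ => ?_
      rw [Finset.mul_sum]
      exact Finset.sum_congr rfl fun q _ => by ring
    have a2 : c m * (∑ p, g m p * y p) * (∑ q, g l q * x q)
        = ∑ p, ∑ q, c m * (g m q * g l p) * x p * y q := by
      rw [mul_assoc, mul_comm (∑ p, g m p * y p), Finset.sum_mul_sum, Finset.mul_sum]
      refine Finset.sum_congr rfl fun p _ => ?_
      rw [Finset.mul_sum]
      exact Finset.sum_congr rfl fun q _ => by ring
    rw [a1, a2, ← Finset.sum_sub_distrib]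
    refine Finset.sum_congr rfl fun p _ => ?_
    rw [← Finset.sum_sub_distrib]
    exact Finset.sum_congr rfl fun q _ => by ring
  rw [e, pow_three, mul_assoc, mul_assoc]
  refine norm_sum_le_card _ fun m => norm_sum_le_card _ fun p => norm_sum_le_card _ fun q => ?_
  simp only [norm_mul]
  have h1 := m2_nonneg g
  have := norm_le_pi_norm c m
  have := norm_le_pi_norm x p
  have := norm_le_pi_norm y q
  have := minor_le g m l p q
  gcongr

lemma nm_smul (r : k) (g : Matrix (Fin d) (Fin d) k) : nm (r • g) = ‖r‖ * nm g := by
  unfold nm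
  rw [← norm_smul]; rfl

lemma m2_smul (r : k) (g : Matrix (Fin d) (Fin d) k) : m2 (r • g) = ‖r‖ ^ 2 * m2 g := by
  unfold m2
  rw [← norm_pow, ← norm_smul]
  congr 1
  ext p
  simp only [Matrix.smul_apply, smul_eq_mul, Pi.smul_apply]
  ring

lemma nm_add (g h : Matrix (Fin d) (Fin d) k) : nm (g + h) ≤ nm g + nm h := by
  unfold nm; exact norm_add_le (fun p : Fin d × Fin d => g p.1 p.2) (fun p => h p.1 p.2)

lemma nm_eq_zero {g : Matrix (Fin d) (Fin d) k} (h : nm g = 0) : g = 0 := by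
  ext i j
  have := entry_le g i j
  rw [h] at this
  simpa using this

end Norms

section SL
variable {k : Type*} [NontriviallyNormedField k] {d : ℕ}

/-- coercion to matrices -/
abbrev M (g : SLgp d k) : Matrix (Fin d) (Fin d) k := (g : Matrix (Fin d) (Fin d) k)

/-- contraction ratio -/
noncomputable def D (g : SLgp d k) : ℝ := m2 (M g) / nm (M g) ^ 2

/-- relative size of `c g` -/
noncomputable def R (c : Fin d → k) (g : SLgp d k) : ℝ := ‖c ᵥ* (M g)‖ / (‖c‖ * nm (M g))

/-- condition number -/
noncomputable def N (g : SLgp d k) : ℝ := d ^ 2 * (nm (M g) * nm (M g⁻¹))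

variable [NeZero d]

lemma nm_pos (g : SLgp d k) : 0 < nm (M g) := by
  rcases (nm_nonneg (M g)).lt_or_eq with h | h
  · exact h
  · exfalso
    have h0 := nm_eq_zero h.symm
    have h1 := g.det_coe
    change (M g).det = 1 at h1
    rw [h0, Matrix.det_zero] at h1
    exact zero_ne_one h1

lemma M_mul (g h : SLgp d k) : M (g * h) = M g * M h := Matrix.SpecialLinearGroup.coe_mul g h
lemma M_one : M (1 : SLgp d k) = 1 := Matrix.SpecialLinearGroup.coe_one

lemma vecMul_ne (c : Fin d → k) (hc : c ≠ 0) (g : SLgp d k) : c ᵥ* M g ≠ 0 := by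
  intro h
  apply hc
  have h2 : c ᵥ* M (g * g⁻¹) = 0 := by
    rw [M_mul, ← Matrix.vecMul_vecMul, h, Matrix.zero_vecMul]
  rwa [mul_inv_cancel, M_one, Matrix.vecMul_one] at h2

lemma dpos : (0:ℝ) < d := by exact_mod_cast Nat.pos_of_ne_zero (NeZero.ne d)

lemma N_pos (g : SLgp d k) : 0 < N g := by
  unfold N
  have := nm_pos g; have := nm_pos g⁻¹; have : (0:ℝ) < d := dpos
  positivity

lemma D_nonneg (g : SLgp d k) : 0 ≤ D g := div_nonneg (m2_nonneg _) (by positivity)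

lemma D_le_two (g : SLgp d k) : D g ≤ 2 := by
  unfold D
  rw [div_le_iff₀ (by have := nm_pos g; positivity)]
  exact m2_le _

lemma R_pos {c : Fin d → k} (hc : c ≠ 0) (g : SLgp d k) : 0 < R c g := by
  unfold R
  have := nm_pos g
  have := norm_pos_iff.2 (vecMul_ne c hc g)
  have := norm_pos_iff.2 hc
  positivity

lemma R_le {c : Fin d → k} (hc : c ≠ 0) (g : SLgp d k) : R c g ≤ d := by
  unfold R
  have := nm_pos g
  have := norm_pos_iff.2 hc
  rw [div_le_iff₀ (by positivity)]
  exact vecMul_le _ _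

lemma nm_one : nm (1 : Matrix (Fin d) (Fin d) k) = 1 := by
  refine le_antisymm (nm_le zero_le_one fun i j => ?_) ?_
  · by_cases h : i = j
    · subst h; simp
    · simp [Matrix.one_apply_ne h]
  · have := entry_le (1 : Matrix (Fin d) (Fin d) k) 0 0
    simpa using this

lemma R_one {c : Fin d → k} (hc : c ≠ 0) : R c (1 : SLgp d k) = 1 := by
  unfold R
  rw [M_one, Matrix.vecMul_one, nm_one, mul_one, div_self (norm_ne_zero_iff.2 hc)]

lemma nm_mul_ge (g h : SLgp d k) : nm (M g) ≤ d * (nm (M (g * h)) * nm (M h⁻¹)) := by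
  have := nm_mul (M (g * h)) (M h⁻¹)
  rwa [← M_mul, mul_inv_cancel_right] at this

lemma R_mul_ge_N {c : Fin d → k} (hc : c ≠ 0) (g h : SLgp d k) : R c g ≤ R c (g * h) * N h := by
  have h1 : ‖c ᵥ* M g‖ ≤ d * (‖c ᵥ* M (g * h)‖ * nm (M h⁻¹)) := by
    have := vecMul_le (M h⁻¹) (c ᵥ* M (g * h))
    rwa [Matrix.vecMul_vecMul, ← M_mul, mul_inv_cancel_right] at this
  have h2 : nm (M (g * h)) ≤ d * (nm (M g) * nm (M h)) := by rw [M_mul]; exact nm_mul _ _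
  have p1 := nm_pos g; have p2 := nm_pos h; have p3 := nm_pos (g * h)
  have p4 := nm_pos h⁻¹
  have p5 := norm_pos_iff.2 hc
  have p6 : (0:ℝ) < d := dpos
  unfold R N
  rw [div_mul_eq_mul_div, div_le_div_iff₀ (by positivity) (by positivity)]
  calc ‖c ᵥ* M g‖ * (‖c‖ * nm (M (g * h)))
      ≤ (d * (‖c ᵥ* M (g * h)‖ * nm (M h⁻¹))) * (‖c‖ * (d * (nm (M g) * nm (M h)))) := by gcongr
    _ = _ := by ring

lemma R_mul_ge_R {c : Fin d → k} (hc : c ≠ 0) (g h : SLgp d k) :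
    R c g * R (c ᵥ* M g) h ≤ d * R c (g * h) := by
  have h2 : nm (M (g * h)) ≤ d * (nm (M g) * nm (M h)) := by rw [M_mul]; exact nm_mul _ _
  have p1 := nm_pos g; have p2 := nm_pos h; have p3 := nm_pos (g * h)
  have p5 := norm_pos_iff.2 hc
  have p7 := norm_pos_iff.2 (vecMul_ne c hc g)
  have p6 : (0:ℝ) < d := dpos
  unfold R
  rw [Matrix.vecMul_vecMul, ← M_mul, div_mul_div_comm, ← mul_div_assoc,
    div_le_div_iff₀ (by positivity) (by positivity)]
  calc ‖c ᵥ* M g‖ * ‖c ᵥ* M (g * h)‖ * (‖c‖ * nm (M (g * h)))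
      ≤ ‖c ᵥ* M g‖ * ‖c ᵥ* M (g * h)‖ * (‖c‖ * (d * (nm (M g) * nm (M h)))) := by gcongr
    _ = _ := by ring

lemma exists_col (c : Fin d → k) (g : Matrix (Fin d) (Fin d) k) :
    ∃ j, ‖c ⬝ᵥ (g *ᵥ Pi.single j 1)‖ = ‖c ᵥ* g‖ := by
  obtain ⟨j, hj⟩ := exists_coord (c ᵥ* g)
  refine ⟨j, ?_⟩
  rw [← hj, Matrix.dotProduct_mulVec, dotProduct_single, mul_one]

lemma norm_single_one (j : Fin d) : ‖(Pi.single j 1 : Fin d → k)‖ = 1 := by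
  rw [Pi.norm_single, norm_one]

/-- basic comparison: `R(g)‖gx‖ ≤ |c(gx)|/‖c‖ + C D(g) ‖g‖ ‖x‖`. -/
lemma R_compare {c : Fin d → k} (hc : c ≠ 0) (g : SLgp d k) (x : Fin d → k) :
    R c g * ‖M g *ᵥ x‖ ≤ d * (‖c ⬝ᵥ (M g *ᵥ x)‖ / ‖c‖) + d ^ 3 * (D g * nm (M g) * ‖x‖) := by
  obtain ⟨j, hj⟩ := exists_col c (M g)
  obtain ⟨l, hl⟩ := exists_coord (M g *ᵥ x)
  have h1 := cross_le (M g) c (Pi.single j 1) x l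
  rw [norm_single_one, mul_one] at h1
  have h2 := norm_sub_norm_le ((c ⬝ᵥ (M g *ᵥ Pi.single j 1)) * (M g *ᵥ x) l)
    ((c ⬝ᵥ (M g *ᵥ x)) * (M g *ᵥ (Pi.single j 1)) l)
  rw [norm_mul, norm_mul, hj, hl] at h2
  have h3 : ‖(M g *ᵥ (Pi.single j 1)) l‖ ≤ nm (M g) := by
    simpa using entry_le (M g) l j
  have p1 := nm_pos g
  have p5 := norm_pos_iff.2 hc
  have p6 : (1:ℝ) ≤ d := by exact_mod_cast Nat.pos_of_ne_zero (NeZero.ne d)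
  have e : R c g * ‖M g *ᵥ x‖ = (‖c ᵥ* M g‖ * ‖M g *ᵥ x‖) / (‖c‖ * nm (M g)) := by
    unfold R; ring
  rw [e, div_le_iff₀ (by positivity)]
  have e2 : (d * (‖c ⬝ᵥ (M g *ᵥ x)‖ / ‖c‖) + d ^ 3 * (D g * nm (M g) * ‖x‖)) * (‖c‖ * nm (M g))
      = d * (‖c ⬝ᵥ (M g *ᵥ x)‖ * nm (M g)) + d ^ 3 * (‖c‖ * m2 (M g) * ‖x‖) := by
    unfold D; field_simp
  rw [e2]
  have h4 : ‖c ⬝ᵥ (M g *ᵥ x)‖ * ‖(M g *ᵥ (Pi.single j 1)) l‖ ≤ d * (‖c ⬝ᵥ (M g *ᵥ x)‖ * nm (M g)) := by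
    calc _ ≤ ‖c ⬝ᵥ (M g *ᵥ x)‖ * nm (M g) := by gcongr
      _ ≤ _ := le_mul_of_one_le_left (by positivity) p6
  linarith

lemma R_drop {c : Fin d → k} (hc : c ≠ 0) (g h : SLgp d k) :
    R c g ≤ d * R c (g * h) + d ^ 3 * (D g * N h) := by
  obtain ⟨i, j, hij⟩ := exists_entry (M (g * h))
  set x : Fin d → k := M h *ᵥ Pi.single j 1 with hx
  have hgx : M g *ᵥ x = M (g * h) *ᵥ Pi.single j 1 := by rw [hx, M_mul, Matrix.mulVec_mulVec]
  have h1 := R_compare hc g x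
  rw [hgx] at h1
  have p0 := R_pos hc g
  have hn : nm (M (g * h)) ≤ ‖M (g * h) *ᵥ (Pi.single j 1 : Fin d → k)‖ := by
    rw [← hij]
    have := norm_le_pi_norm (M (g * h) *ᵥ (Pi.single j 1 : Fin d → k)) i
    simpa using this
  have hcx : ‖c ⬝ᵥ (M (g * h) *ᵥ Pi.single j 1)‖ ≤ ‖c ᵥ* M (g * h)‖ := by
    rw [Matrix.dotProduct_mulVec, dotProduct_single, mul_one]
    exact norm_le_pi_norm _ j
  have hxn : ‖x‖ ≤ d * nm (M h) := by
    have : ‖x‖ ≤ nm (M h) := by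
      have e : x = fun i => M h i j := by
        ext i; simp [hx]
      rw [e]; exact col_norm_le _ _
    have p6 : (1:ℝ) ≤ d := by exact_mod_cast Nat.pos_of_ne_zero (NeZero.ne d)
    exact this.trans (le_mul_of_one_le_left (nm_nonneg _) p6)
  have p1 := nm_pos g; have p2 := nm_pos h; have p3 := nm_pos (g * h)
  have p4 := nm_pos h⁻¹
  have p5 := norm_pos_iff.2 hc
  have p6 : (0:ℝ) < d := dpos
  have hD := D_nonneg g
  have h5 : R c g * nm (M (g * h)) ≤ (d * R c (g * h) + d ^ 3 * (D g * N h)) * nm (M (g * h)) := by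
    calc R c g * nm (M (g * h)) ≤ R c g * ‖M (g * h) *ᵥ (Pi.single j 1 : Fin d → k)‖ := by gcongr
      _ ≤ _ := h1
      _ ≤ d * (‖c ᵥ* M (g * h)‖ / ‖c‖) +
          d ^ 3 * (D g * (d * (nm (M (g * h)) * nm (M h⁻¹))) * (d * nm (M h))) := by
        gcongr
        exact nm_mul_ge g h
      _ = _ := by unfold R N; field_simp
  exact le_of_mul_le_mul_right h5 p3

lemma D_mul_le (g h : SLgp d k) :
    D (g * h) * nm (M (g * h)) ^ 2 ≤ d ^ 2 * (D g * D h) * (nm (M g) * nm (M h)) ^ 2 := by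
  have p1 := nm_pos g; have p2 := nm_pos h; have p3 := nm_pos (g * h)
  have := m2_mul (M g) (M h)
  rw [← M_mul] at this
  unfold D
  have e1 : m2 (M (g * h)) / nm (M (g * h)) ^ 2 * nm (M (g * h)) ^ 2 = m2 (M (g * h)) := by
    field_simp
  have e2 : (d:ℝ) ^ 2 * (m2 (M g) / nm (M g) ^ 2 * (m2 (M h) / nm (M h) ^ 2)) * (nm (M g) * nm (M h)) ^ 2
      = d * (d * (m2 (M g) * m2 (M h))) := by
    field_simp
  rw [e1, e2]; exact this

end SL
end WR

set_option linter.unusedSectionVars false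
namespace WR
section Meas
variable {k : Type*} [NontriviallyNormedField k] [ProperSpace k]
  [MeasurableSpace k] [BorelSpace k] {d : ℕ}

lemma measurable_entry (i j : Fin d) : Measurable fun g : SLgp d k => M g i j := by
  have h1 : Measurable (fun g : {A : Matrix (Fin d) (Fin d) k // A.det = 1} => (g : Matrix (Fin d) (Fin d) k)) :=
    measurable_subtype_coe
  have h2 : Measurable (fun A : Fin d → Fin d → k => A i j) :=
    (measurable_pi_apply j).comp (measurable_pi_apply i)
  exact h2.comp h1

lemma measurable_to_SL {α : Type*} [MeasurableSpace α] {f : α → SLgp d k}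
    (h : ∀ i j, Measurable fun x => M (f x) i j) : Measurable f := by
  have h2 : Measurable (fun x => (M (f x) : Fin d → Fin d → k)) :=
    measurable_pi_iff.2 fun i => measurable_pi_iff.2 fun j => h i j
  exact Measurable.subtype_mk (p := fun A : Matrix (Fin d) (Fin d) k => A.det = 1)
    (f := fun x => M (f x)) (h := fun x => (f x).2) h2

instance : MeasurableMul₂ (SLgp d k) := ⟨by
  refine measurable_to_SL fun i j => ?_
  have : (fun x : SLgp d k × SLgp d k => M (x.1 * x.2) i j) =
      fun x => ∑ l, M x.1 i l * M x.2 l j := by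
    funext x; rw [M, Matrix.SpecialLinearGroup.coe_mul, Matrix.mul_apply]
  rw [this]
  exact Finset.measurable_sum _ fun l _ =>
    ((measurable_entry i l).comp measurable_fst).mul ((measurable_entry l j).comp measurable_snd)⟩

instance instOpensSL : OpensMeasurableSpace (SLgp d k) := by
  have : OpensMeasurableSpace (Fin d → Fin d → k) := inferInstance
  exact inferInstanceAs (OpensMeasurableSpace {A : Fin d → Fin d → k // Matrix.det A = 1})

lemma continuous_entry (i j : Fin d) : Continuous fun g : SLgp d k => M g i j := by
  have h1 : Continuous (fun g : {A : Matrix (Fin d) (Fin d) k // A.det = 1} => (g : Matrix (Fin d) (Fin d) k)) :=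
    continuous_subtype_val
  exact h1.matrix_elem i j

lemma continuous_to_SL {α : Type*} [TopologicalSpace α] {f : α → SLgp d k}
    (h : ∀ i j, Continuous fun x => M (f x) i j) : Continuous f := by
  have h2 : Continuous (fun x => (M (f x))) := continuous_matrix h
  exact Continuous.subtype_mk (p := fun A : Matrix (Fin d) (Fin d) k => A.det = 1)
    (f := fun x => M (f x)) h2 (fun x => (f x).2)

lemma continuous_M : Continuous (M : SLgp d k → _) := continuous_matrix continuous_entry

lemma continuous_mul_SL : Continuous fun x : SLgp d k × SLgp d k => x.1 * x.2 := by
  refine continuous_to_SL fun i j => ?_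
  have : (fun x : SLgp d k × SLgp d k => M (x.1 * x.2) i j) =
      fun x => ∑ l, M x.1 i l * M x.2 l j := by
    funext x; rw [M, Matrix.SpecialLinearGroup.coe_mul, Matrix.mul_apply]
  rw [this]
  exact continuous_finsetSum _ fun l _ =>
    ((continuous_entry i l).comp continuous_fst).mul ((continuous_entry l j).comp continuous_snd)

lemma continuous_inv_SL : Continuous fun x : SLgp d k => x⁻¹ := by
  refine continuous_to_SL fun i j => ?_
  have : (fun x : SLgp d k => M (x⁻¹) i j) = fun x => (M x).adjugate i j := by
    funext x; rw [M, Matrix.SpecialLinearGroup.coe_inv]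
  rw [this]
  exact (continuous_M.matrix_adjugate).matrix_elem i j

lemma continuous_nm : Continuous (nm : Matrix (Fin d) (Fin d) k → ℝ) := by
  refine continuous_norm.comp (continuous_pi fun p => ?_)
  exact continuous_id.matrix_elem _ _

lemma continuous_m2 : Continuous (m2 : Matrix (Fin d) (Fin d) k → ℝ) := by
  refine continuous_norm.comp (continuous_pi fun p => ?_)
  have h : ∀ i j, Continuous fun g : Matrix (Fin d) (Fin d) k => g i j := fun i j =>
    continuous_id.matrix_elem _ _
  exact ((h _ _).mul (h _ _)).sub ((h _ _).mul (h _ _))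

lemma measurable_nmM : Measurable fun g : SLgp d k => nm (M g) :=
  (continuous_nm.comp continuous_M).measurable

lemma measurable_D : Measurable (D : SLgp d k → ℝ) :=
  (continuous_m2.comp continuous_M).measurable.div (measurable_nmM.pow_const 2)

lemma measurable_R (c : Fin d → k) : Measurable (R c : SLgp d k → ℝ) := by
  refine Measurable.div ?_ (measurable_nmM.const_mul _)
  exact (continuous_norm.comp (Continuous.matrix_vecMul continuous_const continuous_M)).measurable

lemma measurable_N : Measurable (N : SLgp d k → ℝ) :=
  (measurable_nmM.mul ((continuous_nm.comp continuous_M).comp continuous_inv_SL).measurable).const_mul _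

open Classical in
/-- inverse of the first nonzero coordinate -/
noncomputable def acoef (v : Fin d → k) : k :=
  ∑ i, if (∀ j < i, v j = 0) ∧ v i ≠ 0 then (v i)⁻¹ else 0

lemma measurable_acoef : Measurable (acoef : (Fin d → k) → k) := by
  refine Finset.measurable_sum _ fun i _ => ?_
  refine Measurable.ite ?_ (measurable_pi_apply i).inv measurable_const
  have h : ∀ j, MeasurableSet {v : Fin d → k | v j = 0} := fun j =>
    measurable_pi_apply j (measurableSet_singleton 0)
  have : {v : Fin d → k | (∀ j < i, v j = 0) ∧ v i ≠ 0} =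
      (⋂ j, ⋂ (_ : j < i), {v | v j = 0}) ∩ {v | v i = 0}ᶜ := by
    ext v; simp
  rw [this]
  exact (MeasurableSet.iInter fun j => MeasurableSet.iInter fun _ => h j).inter (h i).compl

lemma acoef_smul (c : k) (hc : c ≠ 0) (v : Fin d → k) : acoef (c • v) = c⁻¹ * acoef v := by
  unfold acoef
  rw [Finset.mul_sum]
  refine Finset.sum_congr rfl fun i _ => ?_
  have h : ∀ j, c * v j = 0 ↔ v j = 0 := fun j => by simp [hc]
  by_cases hi : (∀ j < i, v j = 0) ∧ v i ≠ 0
  · rw [if_pos hi, if_pos]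
    · simp [mul_comm]
    · exact ⟨fun j hj => (h j).2 (hi.1 j hj), fun hh => hi.2 ((h i).1 hh)⟩
  · rw [if_neg hi, if_neg, mul_zero]
    rintro ⟨h1, h2⟩
    exact hi ⟨fun j hj => (h j).1 (h1 j hj), fun hh => h2 ((h i).2 hh)⟩

lemma acoef_ne (v : Fin d → k) (hv : v ≠ 0) : acoef v ≠ 0 := by
  classical
  have hex : ∃ i, v i ≠ 0 := by
    by_contra h; push Not at h; exact hv (funext h)
  let S : Finset (Fin d) := Finset.univ.filter fun i => v i ≠ 0
  have hS : S.Nonempty := by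
    obtain ⟨i, hi⟩ := hex; exact ⟨i, by simp [S, hi]⟩
  let i := S.min' hS
  have hi : v i ≠ 0 := by
    have := S.min'_mem hS
    simpa [S] using this
  have hlt : ∀ j < i, v j = 0 := by
    intro j hj
    by_contra h
    have : i ≤ j := S.min'_le j (by simp [S, h])
    exact absurd hj (not_lt.2 this)
  have : acoef v = (v i)⁻¹ := by
    unfold acoef
    rw [Finset.sum_eq_single i]
    · rw [if_pos ⟨hlt, hi⟩]
    · intro j _ hj
      rw [if_neg]
      rintro ⟨h1, h2⟩
      rcases lt_trichotomy j i with h | h | h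
      · exact h2 (hlt j h)
      · exact hj h
      · exact hi (h1 i h)
    · simp
  rw [this]; exact inv_ne_zero hi

/-- measurable section of the projective space -/
noncomputable def sec : Projectivization k (Fin d → k) → (Fin d → k) :=
  Projectivization.lift (fun v => acoef (v : Fin d → k) • (v : Fin d → k)) (by
    rintro ⟨a, ha⟩ ⟨b, hb⟩ t h
    dsimp only at h ⊢
    subst h
    have ht : t ≠ 0 := by rintro rfl; simp at ha
    rw [acoef_smul t ht, smul_smul]
    congr 1
    field_simp)

lemma sec_mk (v : Fin d → k) (hv : v ≠ 0) : sec (Projectivization.mk k v hv) = acoef v • v := rfl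

lemma measurable_sec : Measurable (sec : Projectivization k (Fin d → k) → (Fin d → k)) := by
  have h : Measurable (fun v : {v : Fin d → k // v ≠ 0} => acoef (v : Fin d → k) • (v : Fin d → k)) :=
    (measurable_acoef.comp measurable_subtype_coe).smul measurable_subtype_coe
  exact measurable_from_quotient.2 h

/-- homogeneous sets -/
def Homog (B : Set (Fin d → k)) : Prop := ∀ a : k, a ≠ 0 → ∀ x, a • x ∈ B ↔ x ∈ B

lemma sec_ne (p : Projectivization k (Fin d → k)) : sec p ≠ 0 := by
  induction p with
  | h v hv => rw [sec_mk]; exact smul_ne_zero (acoef_ne v hv) hv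

lemma sec_mem_iff {B : Set (Fin d → k)} (hB : Homog B) (v : Fin d → k) (hv : v ≠ 0) :
    sec (Projectivization.mk k v hv) ∈ B ↔ v ∈ B := by
  rw [sec_mk]; exact hB _ (acoef_ne v hv) _

lemma sec_mem_rep {B : Set (Fin d → k)} (hB : Homog B) (p : Projectivization k (Fin d → k)) :
    sec p ∈ B ↔ p.rep ∈ B := by
  conv_lhs => rw [← p.mk_rep]
  exact sec_mem_iff hB _ p.rep_nonzero

lemma homog_pre {B : Set (Fin d → k)} (hB : Homog B) (g : SLgp d k) :
    Homog {x | M g *ᵥ x ∈ B} := by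
  intro a ha x
  simp only [Set.mem_ofPred_eq, Matrix.mulVec_smul]
  exact hB a ha _

lemma sec_pact {B : Set (Fin d → k)} (hB : Homog B) (g : SLgp d k)
    (p : Projectivization k (Fin d → k)) : sec (pact g p) ∈ B ↔ M g *ᵥ sec p ∈ B := by
  induction p with
  | h v hv =>
    have h1 : pact g (Projectivization.mk k v hv) =
      Projectivization.mk k (M g *ᵥ v) (sl_mulVec_ne_zero g hv) := rfl
    rw [h1, sec_mem_iff hB]
    exact (sec_mem_iff (homog_pre hB g) v hv).symm

lemma measurable_mulVec : Measurable fun q : SLgp d k × (Fin d → k) => M q.1 *ᵥ q.2 := by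
  refine measurable_pi_iff.2 fun i => ?_
  have : (fun q : SLgp d k × (Fin d → k) => (M q.1 *ᵥ q.2) i) = fun q => ∑ j, M q.1 i j * q.2 j := by
    funext q; rfl
  rw [this]
  exact Finset.measurable_sum _ fun j _ =>
    ((measurable_entry i j).comp measurable_fst).mul ((measurable_pi_apply j).comp measurable_snd)

lemma measurable_pre {B : Set (Fin d → k)} (hB : MeasurableSet B) (m : Measure (Fin d → k)) [SFinite m] :
    Measurable fun g : SLgp d k => m {x | M g *ᵥ x ∈ B} :=
  measurable_measure_prodMk_left (measurable_mulVec hB)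

/-- invariance of a measure on `k^d` on homogeneous sets. -/
structure Stat (μ : Measure (SLgp d k)) (m : Measure (Fin d → k)) : Prop where
  prob : IsProbabilityMeasure m
  zero : m {0} = 0
  inv : ∀ B, MeasurableSet B → Homog B → ∫⁻ g, m {x | M g *ᵥ x ∈ B} ∂μ = m B

lemma stat_sec (μ : Measure (SLgp d k)) [IsProbabilityMeasure μ]
    (ν : Measure (Projectivization k (Fin d → k))) [IsProbabilityMeasure ν]
    (hν : InvariantMeasure μ pact ν) : Stat μ (ν.map sec) := by
  have hp : IsProbabilityMeasure (ν.map sec) :=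
    Measure.isProbabilityMeasure_map measurable_sec.aemeasurable
  refine ⟨hp, ?_, ?_⟩
  · rw [Measure.map_apply measurable_sec (measurableSet_singleton 0)]
    convert measure_empty (μ := ν)
    ext p; simp [sec_ne p]
  · intro B hB hH
    have hB' : MeasurableSet (sec ⁻¹' B) := measurable_sec hB
    have h := hν ((sec ⁻¹' B).indicator 1) (measurable_one.indicator hB') ⟨1, fun a => by
      by_cases h : a ∈ sec ⁻¹' B <;> simp [h]⟩
    have hin : ∀ g : SLgp d k, ∫ a, (sec ⁻¹' B).indicator (1 : Projectivization k (Fin d → k) → ℝ) (pact g a) ∂ν =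
        ((ν.map sec) {x | M g *ᵥ x ∈ B}).toReal := by
      intro g
      have hm : MeasurableSet {x : Fin d → k | M g *ᵥ x ∈ B} :=
        (measurable_mulVec.comp measurable_prodMk_left) hB
      have : (fun a => (sec ⁻¹' B).indicator (1 : Projectivization k (Fin d → k) → ℝ) (pact g a)) =
          (sec ⁻¹' {x | M g *ᵥ x ∈ B}).indicator (1 : Projectivization k (Fin d → k) → ℝ) := by
        funext a
        have := sec_pact hH g a
        by_cases h1 : M g *ᵥ sec a ∈ B
        · rw [Set.indicator_of_mem (by exact this.2 h1), Set.indicator_of_mem (by exact h1)]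
          rfl
        · rw [Set.indicator_of_notMem (by exact fun h2 => h1 (this.1 h2)),
            Set.indicator_of_notMem (by exact h1)]
      rw [this, integral_indicator_one (measurable_sec hm), Measure.map_apply measurable_sec hm]
      rfl
    simp_rw [hin] at h
    rw [integral_indicator_one hB', integral_toReal (measurable_pre hB _).aemeasurable
      (ae_of_all _ fun g => measure_lt_top _ _)] at h
    rw [Measure.map_apply measurable_sec hB]
    refine (ENNReal.toReal_eq_toReal_iff' ?_ (measure_ne_top _ _)).1 h
    refine ne_top_of_le_ne_top ENNReal.one_ne_top ?_
    calc _ ≤ ∫⁻ g : SLgp d k, 1 ∂μ := lintegral_mono fun g => prob_le_one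
      _ = 1 := by simp

end Meas
end WR

set_option linter.unusedSectionVars false
namespace WR
section Nondeg
variable {k : Type*} [NontriviallyNormedField k] [ProperSpace k]
  [MeasurableSpace k] [BorelSpace k] {d : ℕ}

lemma gamma_subset (μ : Measure (SLgp d k)) (T : Set (SLgp d k)) (hT : IsClosed T)
    (hmul : ∀ a ∈ T, ∀ b ∈ T, a * b ∈ T) (h0 : μ Tᶜ = 0) : GammaMu μ ⊆ T := by
  apply Set.sInter_subset_of_mem
  refine ⟨fun g hg => ?_, hT, hmul⟩
  by_contra hgT
  exact hg Tᶜ hT.isOpen_compl hgT h0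

lemma mulVec_inv_cancel (g : SLgp d k) (x : Fin d → k) : M g⁻¹ *ᵥ (M g *ᵥ x) = x := by
  have : M g⁻¹ * M g = 1 := by
    rw [M, M, ← Matrix.SpecialLinearGroup.coe_mul, inv_mul_cancel, Matrix.SpecialLinearGroup.coe_one]
  rw [Matrix.mulVec_mulVec, this, Matrix.one_mulVec]

lemma mulVec_cancel_inv (g : SLgp d k) (x : Fin d → k) : M g *ᵥ (M g⁻¹ *ᵥ x) = x := by
  have : M g * M g⁻¹ = 1 := by
    rw [M, M, ← Matrix.SpecialLinearGroup.coe_mul, mul_inv_cancel, Matrix.SpecialLinearGroup.coe_one]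
  rw [Matrix.mulVec_mulVec, this, Matrix.one_mulVec]

/-- preimage of a subspace -/
noncomputable abbrev pre (g : SLgp d k) (W : Submodule k (Fin d → k)) : Submodule k (Fin d → k) :=
  W.comap (M g).mulVecLin

lemma mem_pre (g : SLgp d k) (W : Submodule k (Fin d → k)) (x : Fin d → k) :
    x ∈ pre g W ↔ M g *ᵥ x ∈ W := Iff.rfl

lemma finrank_pre (g : SLgp d k) (W : Submodule k (Fin d → k)) :
    Module.finrank k (pre g W) = Module.finrank k W := by
  apply le_antisymm
  · have h : pre g W ≤ W.map (M g⁻¹).mulVecLin := by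
      intro x hx
      exact ⟨M g *ᵥ x, hx, by simpa using mulVec_inv_cancel g x⟩
    exact (Submodule.finrank_mono h).trans (Submodule.finrank_map_le _ _)
  · have h : W ≤ (pre g W).map (M g).mulVecLin := by
      intro x hx
      refine ⟨M g⁻¹ *ᵥ x, ?_, by simpa using mulVec_cancel_inv g x⟩
      change M g *ᵥ (M g⁻¹ *ᵥ x) ∈ W
      rwa [mulVec_cancel_inv]
    exact (Submodule.finrank_mono h).trans (Submodule.finrank_map_le _ _)

lemma pre_injective (g : SLgp d k) : Function.Injective (pre g) := by
  intro W W' h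
  ext x
  have := SetLike.ext_iff.1 h (M g⁻¹ *ᵥ x)
  rwa [mem_pre, mem_pre, mulVec_cancel_inv] at this

lemma closed_sub (W : Submodule k (Fin d → k)) : IsClosed (W : Set (Fin d → k)) :=
  W.closed_of_finiteDimensional

lemma homog_sub (W : Submodule k (Fin d → k)) : Homog (W : Set (Fin d → k)) := by
  intro a ha x
  exact W.smul_mem_iff ha

theorem sub_null (μ : Measure (SLgp d k)) [IsProbabilityMeasure μ] (m : Measure (Fin d → k))
    (hm : Stat μ m) (hirr : StronglyIrred (GammaMu μ)) (W : Submodule k (Fin d → k)) (hW : W ≠ ⊤) :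
    m W = 0 := by
  classical
  have hpr := hm.prob
  by_contra hW0
  have hex : ∃ r, ∃ W : Submodule k (Fin d → k), Module.finrank k W = r ∧ m W ≠ 0 :=
    ⟨_, W, rfl, hW0⟩
  let r := Nat.find hex
  obtain ⟨W1, hW1, hW1m⟩ := Nat.find_spec hex
  change Module.finrank k W1 = r at hW1
  have hmin : ∀ V : Submodule k (Fin d → k), Module.finrank k V < r → m V = 0 := by
    intro V hV
    by_contra h
    exact Nat.find_min hex hV ⟨V, rfl, h⟩
  have hrd : r < Module.finrank k (Fin d → k) :=
    lt_of_le_of_lt (Nat.find_min' hex ⟨W, rfl, hW0⟩) (Submodule.finrank_lt hW)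
  have hr0 : r ≠ 0 := by
    intro h
    rw [h] at hW1
    have : W1 = ⊥ := Submodule.finrank_eq_zero.1 hW1
    rw [this] at hW1m
    exact hW1m (by simpa using hm.zero)
  let ι := {V : Submodule k (Fin d → k) // Module.finrank k V = r}
  have hfin : ∀ e : ℝ≥0∞, 0 < e → Set.Finite {i : ι | e ≤ m (i.1 : Set (Fin d → k))} := by
    intro e he
    refine Measure.finite_const_le_meas_of_disjoint_iUnion₀ m he
      (As := fun i : ι => (i.1 : Set (Fin d → k)))
      (fun i => (closed_sub i.1).measurableSet.nullMeasurableSet) ?_ (measure_ne_top _ _)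
    intro i j hij
    change m ((i.1 : Set (Fin d → k)) ∩ (j.1 : Set (Fin d → k))) = 0
    rw [← Submodule.coe_inf]
    apply hmin
    by_contra hlt
    have h1 : i.1 ⊓ j.1 = i.1 := Submodule.eq_of_le_of_finrank_le inf_le_left (by rw [i.2]; omega)
    have h2 : i.1 ⊓ j.1 = j.1 := Submodule.eq_of_le_of_finrank_le inf_le_right (by rw [j.2]; omega)
    exact hij (Subtype.ext (h1.symm.trans h2))
  obtain ⟨Wm, hWm, hmax⟩ := Set.exists_max_image _ (fun i : ι => m (i.1 : Set (Fin d → k)))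
    (hfin _ (pos_iff_ne_zero.2 hW1m)) ⟨⟨W1, hW1⟩, le_refl (m (W1 : Set (Fin d → k)))⟩
  set α := m (Wm.1 : Set (Fin d → k)) with hα
  have hα0 : 0 < α := lt_of_lt_of_le (pos_iff_ne_zero.2 hW1m) hWm
  have hle : ∀ i : ι, m (i.1 : Set (Fin d → k)) ≤ α := by
    intro i
    by_cases h : m (W1 : Set (Fin d → k)) ≤ m (i.1 : Set (Fin d → k))
    · exact hmax i h
    · exact (not_le.1 h).le.trans hWm
  let Fs : Finset ι := (hfin α hα0).toFinset
  have hFs : ∀ i : ι, i ∈ Fs ↔ α ≤ m (i.1 : Set (Fin d → k)) := by intro i; simp [Fs]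
  let F : Finset (Submodule k (Fin d → k)) := Fs.image Subtype.val
  have hF : ∀ V, V ∈ F ↔ Module.finrank k V = r ∧ α ≤ m (V : Set (Fin d → k)) := by
    intro V
    simp only [F, Finset.mem_image, hFs]
    constructor
    · rintro ⟨i, hi, rfl⟩; exact ⟨i.2, hi⟩
    · rintro ⟨h1, h2⟩; exact ⟨⟨V, h1⟩, h2, rfl⟩
  have hae : ∀ V ∈ F, ∀ᵐ g ∂μ, pre g V ∈ F := by
    intro V hV
    rw [hF] at hV
    have hinv := hm.inv V (closed_sub V).measurableSet (homog_sub V)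
    have hpt : ∀ g : SLgp d k, m {x | M g *ᵥ x ∈ (V : Set (Fin d → k))} ≤ α := fun g =>
      hle ⟨pre g V, by rw [finrank_pre]; exact hV.1⟩
    have := ae_eq_of_ae_le_of_lintegral_le (μ := μ)
      (f := fun g => m {x | M g *ᵥ x ∈ (V : Set (Fin d → k))}) (g := fun _ => α)
      (ae_of_all _ hpt) (by rw [hinv]; exact measure_ne_top _ _) aemeasurable_const
      (by rw [hinv]; simpa using hV.2)
    filter_upwards [this] with g hg
    rw [hF, finrank_pre]
    exact ⟨hV.1, hg.ge⟩
  have hae' : ∀ᵐ g ∂μ, ∀ V ∈ F, pre g V ∈ F := (ae_ball_iff F.countable_toSet).2 hae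
  let T : Set (SLgp d k) := {g | ∀ V ∈ F, ∃ V' ∈ F, ∀ x ∈ V, M g *ᵥ x ∈ V'}
  have hTc : IsClosed T := by
    have : T = ⋂ V ∈ F, ⋃ V' ∈ F, ⋂ x ∈ V, {g : SLgp d k | M g *ᵥ x ∈ V'} := by
      ext g; simp [T]
    rw [this]
    refine isClosed_biInter fun V _ => ?_
    refine Set.Finite.isClosed_biUnion F.finite_toSet fun V' _ => ?_
    refine isClosed_biInter fun x _ => ?_
    exact (closed_sub V').preimage (Continuous.matrix_mulVec continuous_M continuous_const)
  have hTm : ∀ a ∈ T, ∀ b ∈ T, a * b ∈ T := by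
    intro a ha b hb V hV
    obtain ⟨V', hV', h1⟩ := hb V hV
    obtain ⟨V'', hV'', h2⟩ := ha V' hV'
    refine ⟨V'', hV'', fun x hx => ?_⟩
    rw [M, Matrix.SpecialLinearGroup.coe_mul, ← Matrix.mulVec_mulVec]
    exact h2 _ (h1 x hx)
  have hT0 : μ Tᶜ = 0 := by
    have : ∀ᵐ g ∂μ, g ∈ T := by
      filter_upwards [hae'] with g hg
      intro V hV
      have hsurj : Set.SurjOn (pre g) (F : Set (Submodule k (Fin d → k))) F :=
        Finset.surjOn_of_injOn_of_card_le (pre g) (fun V hV => hg V hV)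
          (pre_injective g).injOn le_rfl
      obtain ⟨V', hV', h⟩ := hsurj hV
      exact ⟨V', hV', fun x hx => by rw [← h] at hx; exact hx⟩
    exact this
  have hΓ := gamma_subset μ T hTc hTm hT0
  refine hirr F ⟨Wm.1, (hF _).2 ⟨Wm.2, le_rfl⟩⟩ ?_ ?_
  · intro V hV
    rw [hF] at hV
    constructor
    · rintro rfl
      exact hr0 (by rw [← hV.1]; simp)
    · rintro rfl
      have := hV.1
      rw [finrank_top] at this
      omega
  · rintro g hg x ⟨V, hV, hx⟩
    obtain ⟨V', hV', h⟩ := hΓ hg V hV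
    exact ⟨V', hV', h x hx⟩

/-- neighbourhood of a hyperplane -/
def Nb (c : Fin d → k) (κ : ℝ) : Set (Fin d → k) := {x | ‖c ⬝ᵥ x‖ ≤ κ * (‖c‖ * ‖x‖)}

lemma mem_Nb (c : Fin d → k) (κ : ℝ) (x : Fin d → k) :
    x ∈ Nb c κ ↔ ‖c ⬝ᵥ x‖ ≤ κ * (‖c‖ * ‖x‖) := Iff.rfl

lemma closed_Nb (c : Fin d → k) (κ : ℝ) : IsClosed (Nb c κ) := by
  refine isClosed_le (continuous_norm.comp ?_) (by fun_prop)
  exact Continuous.dotProduct continuous_const continuous_id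

lemma homog_Nb (c : Fin d → k) (κ : ℝ) : Homog (Nb c κ) := by
  intro a ha x
  have h : 0 < ‖a‖ := norm_pos_iff.2 ha
  change ‖c ⬝ᵥ (a • x)‖ ≤ κ * (‖c‖ * ‖a • x‖) ↔ ‖c ⬝ᵥ x‖ ≤ κ * (‖c‖ * ‖x‖)
  rw [dotProduct_smul, smul_eq_mul, norm_mul, norm_smul,
    show κ * (‖c‖ * (‖a‖ * ‖x‖)) = ‖a‖ * (κ * (‖c‖ * ‖x‖)) by ring]
  exact mul_le_mul_iff_right₀ h

lemma Nb_mono (c : Fin d → k) {κ κ' : ℝ} (h : κ ≤ κ') : Nb c κ ⊆ Nb c κ' := by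
  intro x hx
  rw [mem_Nb] at hx ⊢
  exact hx.trans (mul_le_mul_of_nonneg_right h (by positivity))

lemma Nb_smul (c : Fin d → k) (κ : ℝ) (a : k) (ha : a ≠ 0) : Nb (a • c) κ = Nb c κ := by
  have h : 0 < ‖a‖ := norm_pos_iff.2 ha
  ext x
  change ‖(a • c) ⬝ᵥ x‖ ≤ κ * (‖a • c‖ * ‖x‖) ↔ ‖c ⬝ᵥ x‖ ≤ κ * (‖c‖ * ‖x‖)
  rw [smul_dotProduct, smul_eq_mul, norm_mul, norm_smul,
    show κ * (‖a‖ * ‖c‖ * ‖x‖) = ‖a‖ * (κ * (‖c‖ * ‖x‖)) by ring]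
  exact mul_le_mul_iff_right₀ h

theorem phi_small [NeZero d] (μ : Measure (SLgp d k)) [IsProbabilityMeasure μ]
    (m : Measure (Fin d → k))
    (hm : Stat μ m) (hirr : StronglyIrred (GammaMu μ)) (ε : ℝ≥0∞) (hε : 0 < ε) :
    ∃ κ : ℝ, 0 < κ ∧ ∀ c : Fin d → k, c ≠ 0 → m (Nb c κ) ≤ ε := by
  have hpr := hm.prob
  by_contra hcon
  push Not at hcon
  have hseq : ∀ n : ℕ, ∃ c : Fin d → k, ‖c‖ = 1 ∧ ε < m (Nb c (1 / ((n:ℝ) + 1))) := by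
    intro n
    obtain ⟨c, hc, h⟩ := hcon (1 / ((n:ℝ) + 1)) (by positivity)
    obtain ⟨i, hi⟩ := exists_coord c
    have hci : c i ≠ 0 := by
      rw [← norm_ne_zero_iff, hi]; exact norm_ne_zero_iff.2 hc
    refine ⟨(c i)⁻¹ • c, ?_, ?_⟩
    · rw [norm_smul, norm_inv, hi, inv_mul_cancel₀ (norm_ne_zero_iff.2 hc)]
    · rwa [Nb_smul _ _ _ (inv_ne_zero hci)]
  choose cs hcs hcm using hseq
  obtain ⟨c, hc, φ, hφ, hlim⟩ := (isCompact_sphere (0 : Fin d → k) 1).tendsto_subseq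
    (x := cs) (fun n => by simp [hcs n])
  have hc1 : ‖c‖ = 1 := by simpa using hc
  have hbig : ∀ j : ℕ, ε ≤ m (Nb c (1 / ((j:ℝ) + 1))) := by
    intro j
    have hdp : (0:ℝ) < d := dpos
    have hj : (0:ℝ) < 1 / ((j:ℝ) + 1) := by positivity
    have e1 : ∀ᶠ n in atTop, ‖cs (φ n) - c‖ < 1 / ((j:ℝ) + 1) / (2 * d) := by
      have := (tendsto_iff_norm_sub_tendsto_zero.1 hlim)
      exact this.eventually_lt_const (by positivity)
    have e2 : ∀ᶠ n in atTop, 1 / ((φ n : ℝ) + 1) < 1 / ((j:ℝ) + 1) / 2 := by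
      have := (tendsto_one_div_add_atTop_nhds_zero_nat (𝕜 := ℝ)).comp hφ.tendsto_atTop
      exact this.eventually_lt_const (by positivity)
    obtain ⟨n, h1, h2⟩ := (e1.and e2).exists
    refine (hcm (φ n)).le.trans (measure_mono fun x hx => ?_)
    rw [mem_Nb] at hx ⊢
    rw [hcs, one_mul] at hx
    rw [hc1, one_mul]
    have h3 : c ⬝ᵥ x = cs (φ n) ⬝ᵥ x - (cs (φ n) - c) ⬝ᵥ x := by
      rw [sub_dotProduct]; ring
    have h4 := dot_le (cs (φ n) - c) x
    calc ‖c ⬝ᵥ x‖ ≤ ‖cs (φ n) ⬝ᵥ x‖ + ‖(cs (φ n) - c) ⬝ᵥ x‖ := by rw [h3]; exact norm_sub_le _ _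
      _ ≤ 1 / ((φ n : ℝ) + 1) * ‖x‖ + d * (‖cs (φ n) - c‖ * ‖x‖) := add_le_add hx h4
      _ ≤ 1 / ((j:ℝ) + 1) / 2 * ‖x‖ + d * (1 / ((j:ℝ) + 1) / (2 * d) * ‖x‖) := by gcongr
      _ = 1 / ((j:ℝ) + 1) * ‖x‖ := by field_simp; ring
  have hanti : Antitone fun j : ℕ => Nb c (1 / ((j:ℝ) + 1)) := by
    intro i j hij
    exact Nb_mono c (one_div_le_one_div_of_le (by positivity) (by gcongr))
  have hlim2 := tendsto_measure_iInter_atTop (μ := m)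
    (fun j : ℕ => (closed_Nb c (1 / ((j:ℝ) + 1))).measurableSet.nullMeasurableSet) hanti
    ⟨0, measure_ne_top _ _⟩
  have hge : ε ≤ m (⋂ j : ℕ, Nb c (1 / ((j:ℝ) + 1))) :=
    ge_of_tendsto hlim2 (Eventually.of_forall hbig)
  let W : Submodule k (Fin d → k) := LinearMap.ker (dotProductBilin k k c)
  have hWmem : ∀ x, x ∈ W ↔ c ⬝ᵥ x = 0 := fun x => Iff.rfl
  have hsub : (⋂ j : ℕ, Nb c (1 / ((j:ℝ) + 1))) ⊆ (W : Set (Fin d → k)) := by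
    intro x hx
    rw [Set.mem_iInter] at hx
    change x ∈ W
    rw [hWmem, ← norm_le_zero_iff]
    have := (tendsto_one_div_add_atTop_nhds_zero_nat (𝕜 := ℝ)).mul_const (‖c‖ * ‖x‖)
    rw [zero_mul] at this
    exact ge_of_tendsto this (Eventually.of_forall hx)
  have hWt : W ≠ ⊤ := by
    intro h
    obtain ⟨i, hi⟩ := exists_coord c
    have : (Pi.single i 1 : Fin d → k) ∈ W := by rw [h]; trivial
    rw [hWmem, dotProduct_single, mul_one] at this
    rw [this, norm_zero, hc1] at hi
    exact zero_ne_one hi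
  have h0 := sub_null μ m hm hirr W hWt
  have := hge.trans ((measure_mono hsub).trans h0.le)
  exact absurd this (not_le.2 hε)

end Nondeg
end WR

set_option linter.unusedSectionVars false
namespace WR
section Psi
variable {k : Type*} [NontriviallyNormedField k] [ProperSpace k]
  [MeasurableSpace k] [BorelSpace k] {d : ℕ} [NeZero d]

lemma mem_row_Nb (g : SLgp d k) : ∃ c : Fin d → k, c ≠ 0 ∧ ‖c‖ = nm (M g) ∧
    (∀ h : SLgp d k, ‖c ᵥ* M h‖ ≤ nm (M (g * h))) ∧
    ∀ (κ : ℝ) (x : Fin d → k), ‖M g *ᵥ x‖ ≤ κ * (nm (M g) * ‖x‖) → x ∈ Nb c κ := by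
  obtain ⟨i, hi⟩ := exists_row (M g)
  refine ⟨M g i, ?_, hi, fun h => ?_, fun κ x hx => ?_⟩
  · rw [← norm_ne_zero_iff, hi]; exact (nm_pos g).ne'
  · rw [M_mul]; exact row_vecMul_le (M g) (M h) i
  · rw [mem_Nb, hi]
    exact (norm_le_pi_norm (M g *ᵥ x) i).trans hx

lemma Pop_stat (μ : Measure (SLgp d k)) (m : Measure (Fin d → k)) (hm : Stat μ m)
    {B : Set (Fin d → k)} (hB : MeasurableSet B) (hH : Homog B) (g : SLgp d k) :
    Pop μ (fun g => m {x | M g *ᵥ x ∈ B}) g = m {x | M g *ᵥ x ∈ B} := by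
  have hm' : MeasurableSet {x : Fin d → k | M g *ᵥ x ∈ B} :=
    (measurable_mulVec.comp measurable_prodMk_left) hB
  rw [← hm.inv _ hm' (homog_pre hH g)]
  unfold Pop
  refine lintegral_congr fun h => ?_
  refine congrArg (fun s : Set (Fin d → k) => m s) (Set.ext fun x => ?_)
  change M (g * h) *ᵥ x ∈ B ↔ M g *ᵥ (M h *ᵥ x) ∈ B
  rw [M_mul, Matrix.mulVec_mulVec]

lemma It_stat (μ : Measure (SLgp d k)) (m : Measure (Fin d → k)) (hm : Stat μ m)
    {B : Set (Fin d → k)} (hB : MeasurableSet B) (hH : Homog B) (n : ℕ) (g : SLgp d k) :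
    It μ n (fun g => m {x | M g *ᵥ x ∈ B}) g = m {x | M g *ᵥ x ∈ B} := by
  induction n generalizing g with
  | zero => rfl
  | succ n ih =>
    have : It μ n (fun g => m {x | M g *ᵥ x ∈ B}) = fun g => m {x | M g *ᵥ x ∈ B} := funext ih
    change Pop μ (It μ n _) g = _
    rw [this]
    exact Pop_stat μ m hm hB hH g

theorem psi_small (μ : Measure (SLgp d k)) [IsProbabilityMeasure μ]
    (m : Measure (Fin d → k))
    (hm : Stat μ m) (hirr : StronglyIrred (GammaMu μ)) (ε : ℝ≥0∞) (hε : 0 < ε) :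
    ∃ η : ℝ, 0 < η ∧ ∀ c : Fin d → k, c ≠ 0 → ∀ n,
      Rew μ {h | R c h < η} (fun _ => 1) n 1 ≤ ε := by
  have hpr := hm.prob
  have hdp : (0:ℝ) < d := dpos
  obtain ⟨κ, hκ, hκm⟩ := phi_small μ m hm hirr (1/2) (by simp)
  obtain ⟨δ, hδ, hδm⟩ := phi_small μ m hm hirr (ε/2) (ENNReal.half_pos hε.ne')
  refine ⟨δ * κ / d, by positivity, fun c hc n => ?_⟩
  have hc0 := norm_pos_iff.2 hc
  have key := max_ineq μ (A := {h : SLgp d k | R c h < δ * κ / d})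
    (F := fun g => m {x | M g *ᵥ x ∈ Nb c δ})
    (fun g => (Pop_stat μ m hm (closed_Nb c δ).measurableSet (homog_Nb c δ) g).le) 2 (by simp)
    ?_ n 1
  · refine key.trans ?_
    have : {x : Fin d → k | M (1 : SLgp d k) *ᵥ x ∈ Nb c δ} = Nb c δ := by
      ext x
      change M (1 : SLgp d k) *ᵥ x ∈ Nb c δ ↔ _
      rw [M_one, Matrix.one_mulVec]
    rw [this]
    calc 2 * m (Nb c δ) ≤ 2 * (ε / 2) := by gcongr; exact hδm c hc
      _ = ε := ENNReal.mul_div_cancel (by simp) (by simp)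
  · intro g hg
    change R c g < δ * κ / d at hg
    obtain ⟨c', hc', hcn, -, hc2⟩ := mem_row_Nb g
    have hsub : (Nb c' κ)ᶜ ⊆ {x | M g *ᵥ x ∈ Nb c δ} := by
      intro x hx
      change M g *ᵥ x ∈ Nb c δ
      have h1 : κ * (nm (M g) * ‖x‖) < ‖M g *ᵥ x‖ := by
        by_contra h
        exact hx (hc2 κ x (not_lt.1 h))
      have p1 := nm_pos g
      rw [mem_Nb, Matrix.dotProduct_mulVec]
      have h2 := dot_le (c ᵥ* M g) x
      unfold R at hg
      rw [div_lt_iff₀ (by positivity)] at hg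
      calc _ ≤ d * (‖c ᵥ* M g‖ * ‖x‖) := h2
        _ ≤ d * (δ * κ / d * (‖c‖ * nm (M g)) * ‖x‖) := by gcongr
        _ = δ * ‖c‖ * (κ * (nm (M g) * ‖x‖)) := by field_simp
        _ ≤ δ * ‖c‖ * ‖M g *ᵥ x‖ := by gcongr
        _ = _ := by ring
    have h3 : 1/2 ≤ m (Nb c' κ)ᶜ := by
      rw [prob_compl_eq_one_sub (closed_Nb c' κ).measurableSet]
      calc (1/2 : ℝ≥0∞) = 1 - 1/2 := by simp
        _ ≤ _ := tsub_le_tsub_left (hκm c' hc') _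
    calc (1:ℝ≥0∞) = 2 * (1/2) := by rw [ENNReal.mul_div_cancel (by simp) (by simp)]
      _ ≤ 2 * m {x | M g *ᵥ x ∈ Nb c δ} := by
        gcongr
        exact h3.trans (measure_mono hsub)

theorem psi_norm (μ : Measure (SLgp d k)) [IsProbabilityMeasure μ]
    (m : Measure (Fin d → k))
    (hm : Stat μ m) (hirr : StronglyIrred (GammaMu μ)) (ε : ℝ≥0∞) (hε : 0 < ε) :
    ∃ κ : ℝ, 0 < κ ∧ ∀ (g : SLgp d k) (B : Set (SLgp d k)),
      (∀ h, g * h ∈ B → nm (M (g * h)) < κ * (nm (M g) * nm (M h))) → ∀ n,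
      Rew μ B (fun _ => 1) n g ≤ ε := by
  obtain ⟨η, hη, h⟩ := psi_small μ m hm hirr ε hε
  refine ⟨η, hη, fun g B hB n => ?_⟩
  obtain ⟨c, hc, hcn, hc2, -⟩ := mem_row_Nb g
  have h1 := hit_translate μ (E := B) (A := {h | R c h < η}) g (fun x hx => ?_) n 1
  · rw [mul_one] at h1
    exact h1.trans (h c hc n)
  · change R c x < η
    have p1 := nm_pos g; have p2 := nm_pos x
    unfold R
    rw [hcn, div_lt_iff₀ (by positivity)]
    exact (hc2 x).trans_lt (hB x hx)

end Psi
end WR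

set_option linter.unusedSectionVars false
namespace WR
section Contr
variable {k : Type*} [NontriviallyNormedField k] [ProperSpace k]
  [MeasurableSpace k] [BorelSpace k] {d : ℕ} [NeZero d]

lemma gamma_reach (μ : Measure (SLgp d k)) [IsProbabilityMeasure μ] (γ : SLgp d k)
    (hγ : γ ∈ GammaMu μ) (U : Set (SLgp d k)) (hU : IsOpen U) (hγU : γ ∈ U) :
    ∃ m, It μ m (ind U) 1 ≠ 0 := by
  let S : Set (SLgp d k) := {γ | ∀ U : Set (SLgp d k), IsOpen U → γ ∈ U → ∃ m, It μ m (ind U) 1 ≠ 0}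
  have hS : GammaMu μ ⊆ S := by
    apply Set.sInter_subset_of_mem
    refine ⟨?_, ?_, ?_⟩
    · intro g hg U hU hgU
      refine ⟨1, ?_⟩
      have : It μ 1 (ind U) 1 = μ U := by
        change ∫⁻ h, ind U (1 * h) ∂μ = μ U
        rw [← lintegral_indicator_one hU.measurableSet]
        refine lintegral_congr fun h => ?_
        rw [one_mul]
        unfold ind Set.indicator
        rfl
      rw [this]
      exact hg U hU hgU
    · refine isClosed_of_closure_subset fun γ hγ U hU hγU => ?_
      obtain ⟨γ', h1, h2⟩ := mem_closure_iff.1 hγ U hU hγU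
      exact h2 U hU h1
    · intro a ha b hb U hU hab
      obtain ⟨Ua, Ub, hUa, hUb, haU, hbU, hsub⟩ := isOpen_prod_iff.1 (hU.preimage continuous_mul_SL) a b hab
      obtain ⟨m, hm⟩ := ha Ua hUa haU
      obtain ⟨n, hn⟩ := hb Ub hUb hbU
      refine ⟨m + n, ?_⟩
      rw [It_add_time]
      have h1 : ∀ g, It μ n (ind Ub) 1 * ind Ua g ≤ It μ n (ind U) g := by
        intro g
        by_cases hg : g ∈ Ua
        · have h2 : It μ n (ind Ub) 1 ≤ It μ n (fun x => ind U (g * x)) 1 := by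
            refine It_mono μ (fun x => ?_) n 1
            by_cases hx : x ∈ Ub
            · have : g * x ∈ U := hsub (Set.mk_mem_prod hg hx)
              simp [ind, hx, this]
            · simp [ind, hx]
          rw [It_translate, mul_one] at h2
          simpa [ind, hg] using h2
        · simp [ind, hg]
      have h2 := It_mono μ h1 m 1
      rw [It_const_mul μ _ _ (ne_top_of_le_ne_top ENNReal.one_ne_top (It_le_const μ (ind_le_one Ub) n 1))] at h2
      intro h0
      rw [h0] at h2
      exact mul_ne_zero hn hm (le_antisymm h2 zero_le)
  exact hS hγ U hU hγU

lemma gamma_mul (μ : Measure (SLgp d k)) {a b : SLgp d k} (ha : a ∈ GammaMu μ)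
    (hb : b ∈ GammaMu μ) : a * b ∈ GammaMu μ := by
  intro S hS
  exact hS.2.2 a (ha S hS) b (hb S hS)

lemma rank_one_col (A : Matrix (Fin d) (Fin d) k) (hA : A.rank = 1) :
    m2 A = 0 ∧ ∃ j, A *ᵥ Pi.single j 1 ≠ 0 := by
  unfold Matrix.rank at hA
  obtain ⟨v, hv, h⟩ := finrank_eq_one_iff'.1 hA
  have hc : ∀ j, ∃ c : k, ∀ i, A i j = c * v.1 i := by
    intro j
    obtain ⟨c, hc⟩ := h ⟨A *ᵥ Pi.single j 1, ⟨Pi.single j 1, rfl⟩⟩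
    refine ⟨c, fun i => ?_⟩
    have := congrFun (congrArg Subtype.val hc) i
    simpa using this.symm
  choose c hc using hc
  constructor
  · refine le_antisymm (m2_le_of le_rfl fun i l j m => ?_) (m2_nonneg A)
    rw [hc, hc, hc, hc, norm_le_zero_iff]
    ring
  · by_contra hcon
    push Not at hcon
    have hA0 : A = 0 := by
      ext i j
      have := congrFun (hcon j) i
      simpa using this
    obtain ⟨x, hx⟩ := v.2
    apply hv
    ext i
    rw [← hx, hA0]; simp

lemma orbit_span (μ : Measure (SLgp d k)) (hirr : StronglyIrred (GammaMu μ))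
    (γ : SLgp d k) (hγ : γ ∈ GammaMu μ) (v : Fin d → k) (hv : v ≠ 0) :
    Submodule.span k ((fun u : SLgp d k => M u *ᵥ v) '' GammaMu μ) = ⊤ := by
  by_contra hW
  set W := Submodule.span k ((fun u : SLgp d k => M u *ᵥ v) '' GammaMu μ) with hWdef
  have hsub : ∀ u ∈ GammaMu μ, M u *ᵥ v ∈ W := fun u hu => Submodule.subset_span ⟨u, hu, rfl⟩
  refine hirr {W} ⟨W, by simp⟩ ?_ ?_
  · intro V hV
    rw [Finset.mem_singleton] at hV
    subst hV
    refine ⟨fun h => ?_, hW⟩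
    have := hsub γ hγ
    rw [h, Submodule.mem_bot] at this
    exact sl_mulVec_ne_zero γ hv this
  · rintro g hg x ⟨V, hV, hx⟩
    rw [Finset.mem_singleton] at hV
    rw [hV] at hx
    refine ⟨W, by simp, ?_⟩
    have h : W ≤ pre g W := by
      rw [hWdef, Submodule.span_le]
      rintro _ ⟨u, hu, rfl⟩
      change M g *ᵥ (M u *ᵥ v) ∈ W
      rw [Matrix.mulVec_mulVec, ← M_mul]
      exact hsub _ (gamma_mul μ hg hu)
    exact h hx

lemma span_bound (Γ : Set (SLgp d k)) (v : Fin d → k)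
    (hspan : Submodule.span k ((fun u : SLgp d k => M u *ᵥ v) '' Γ) = ⊤) (x : Fin d → k) :
    ∃ (F : Finset (SLgp d k)) (C : ℝ), (↑F ⊆ Γ) ∧ 0 ≤ C ∧
      ∀ g : Matrix (Fin d) (Fin d) k, ‖g *ᵥ x‖ ≤ C * ∑ u ∈ F, ‖g *ᵥ (M u *ᵥ v)‖ := by
  classical
  have hx : x ∈ Submodule.span k ((fun u : SLgp d k => M u *ᵥ v) '' Γ) := by rw [hspan]; trivial
  induction hx using Submodule.span_induction with
  | mem x hx =>
    obtain ⟨u, hu, rfl⟩ := hx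
    exact ⟨{u}, 1, by simpa using hu, zero_le_one, fun g => by simp⟩
  | zero => exact ⟨∅, 0, by simp, le_rfl, fun g => by simp⟩
  | add x y _ _ ihx ihy =>
    obtain ⟨F1, C1, h1, h1', h1''⟩ := ihx
    obtain ⟨F2, C2, h2, h2', h2''⟩ := ihy
    refine ⟨F1 ∪ F2, C1 + C2, by simp [h1, h2], by positivity, fun g => ?_⟩
    have e1 : ∑ u ∈ F1, ‖g *ᵥ (M u *ᵥ v)‖ ≤ ∑ u ∈ F1 ∪ F2, ‖g *ᵥ (M u *ᵥ v)‖ :=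
      Finset.sum_le_sum_of_subset_of_nonneg Finset.subset_union_left fun _ _ _ => norm_nonneg _
    have e2 : ∑ u ∈ F2, ‖g *ᵥ (M u *ᵥ v)‖ ≤ ∑ u ∈ F1 ∪ F2, ‖g *ᵥ (M u *ᵥ v)‖ :=
      Finset.sum_le_sum_of_subset_of_nonneg Finset.subset_union_right fun _ _ _ => norm_nonneg _
    rw [Matrix.mulVec_add, add_mul]
    exact (norm_add_le _ _).trans (add_le_add ((h1'' g).trans (by gcongr)) ((h2'' g).trans (by gcongr)))
  | smul a x _ ih =>
    obtain ⟨F, C, h1, h2, h3⟩ := ih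
    refine ⟨F, ‖a‖ * C, h1, by positivity, fun g => ?_⟩
    rw [Matrix.mulVec_smul, norm_smul, mul_assoc]
    gcongr
    exact h3 g

lemma exists_good (Γ : Set (SLgp d k)) (v : Fin d → k)
    (hspan : Submodule.span k ((fun u : SLgp d k => M u *ᵥ v) '' Γ) = ⊤) :
    ∃ (F : Finset (SLgp d k)) (C : ℝ), (↑F ⊆ Γ) ∧ 0 < C ∧
      ∀ g : SLgp d k, ∃ u ∈ F, nm (M g) ≤ C * ‖M g *ᵥ (M u *ᵥ v)‖ := by
  classical
  choose F C hF hC h using fun j : Fin d => span_bound Γ v hspan (Pi.single j 1)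
  let F' := Finset.univ.biUnion F
  let C' := ∑ j, C j
  have hC' : 0 ≤ C' := Finset.sum_nonneg fun j _ => hC j
  have key : ∀ g : SLgp d k, nm (M g) ≤ C' * ∑ u ∈ F', ‖M g *ᵥ (M u *ᵥ v)‖ := by
    intro g
    have hs : 0 ≤ ∑ u ∈ F', ‖M g *ᵥ (M u *ᵥ v)‖ := Finset.sum_nonneg fun _ _ => norm_nonneg _
    refine nm_le (by positivity) fun i j => ?_
    have h1 : ‖M g i j‖ ≤ ‖M g *ᵥ Pi.single j 1‖ := by
      have := norm_le_pi_norm (M g *ᵥ Pi.single j 1) i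
      simpa using this
    refine h1.trans ((h j (M g)).trans ?_)
    refine mul_le_mul ?_ ?_ (Finset.sum_nonneg fun _ _ => norm_nonneg _) hC'
    · exact Finset.single_le_sum (fun j _ => hC j) (Finset.mem_univ j)
    · exact Finset.sum_le_sum_of_subset_of_nonneg
        (Finset.subset_biUnion_of_mem F (Finset.mem_univ j)) fun _ _ _ => norm_nonneg _
  refine ⟨F', C' * F'.card + 1, ?_, by positivity, fun g => ?_⟩
  · intro u hu
    simp only [F', Finset.coe_biUnion, Set.mem_iUnion] at hu
    obtain ⟨j, _, hj⟩ := hu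
    exact hF j hj
  · have hne : F'.Nonempty := by
      by_contra hne
      rw [Finset.not_nonempty_iff_eq_empty] at hne
      have := key g
      rw [hne] at this
      simp only [Finset.sum_empty, mul_zero] at this
      exact absurd (nm_pos g) (not_lt.2 this)
    obtain ⟨u, hu, hmax⟩ := F'.exists_max_image (fun u => ‖M g *ᵥ (M u *ᵥ v)‖) hne
    refine ⟨u, hu, ?_⟩
    have h2 : ∑ u ∈ F', ‖M g *ᵥ (M u *ᵥ v)‖ ≤ F'.card * ‖M g *ᵥ (M u *ᵥ v)‖ := by
      have := Finset.sum_le_card_nsmul F' _ _ hmax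
      simpa using this
    calc nm (M g) ≤ C' * ∑ u ∈ F', ‖M g *ᵥ (M u *ᵥ v)‖ := key g
      _ ≤ C' * (F'.card * ‖M g *ᵥ (M u *ᵥ v)‖) := by gcongr
      _ ≤ (C' * F'.card + 1) * ‖M g *ᵥ (M u *ᵥ v)‖ := by
        have := norm_nonneg (M g *ᵥ (M u *ᵥ v)); nlinarith

lemma D_good {A : Matrix (Fin d) (Fin d) k} {j : Fin d} {C η : ℝ} (hC : 0 < C) (hη : 0 < η)
    {g u w : SLgp d k} (h : nm (M g) ≤ C * ‖M g *ᵥ (M u *ᵥ (A *ᵥ Pi.single j 1))‖)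
    {r : k} (hr : r ≠ 0) (h1 : nm (r • M w - M u * A) ≤ 1 / (2 * C * d))
    (h2 : m2 (r • M w) ≤ η / (8 * d ^ 2 * C ^ 2)) : D (g * w) ≤ η := by
  have hdp : (0:ℝ) < d := dpos
  have p1 := nm_pos g; have p2 := nm_pos (g * w); have pr := norm_pos_iff.2 hr
  have e1 : ‖M g *ᵥ (M u *ᵥ (A *ᵥ Pi.single j 1))‖ ≤ nm (M g * (M u * A)) := by
    rw [Matrix.mulVec_mulVec, Matrix.mulVec_mulVec]
    refine (pi_norm_le_iff_of_nonneg (nm_nonneg _)).2 fun i => ?_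
    rw [Matrix.mulVec_single_one]
    rw [Matrix.mul_assoc]
    exact entry_le (M g * (M u * A)) i j
  have e2 : nm (M g * (M u * A)) ≤ nm (r • M (g * w)) + d * (nm (M g) * (1 / (2 * C * d))) := by
    have : M g * (M u * A) = r • M (g * w) + M g * (-(r • M w - M u * A)) := by
      rw [M_mul]; simp [Matrix.mul_sub]
    rw [this]
    refine (nm_add _ _).trans (add_le_add le_rfl ((nm_mul _ _).trans ?_))
    have : nm (-(r • M w - M u * A)) = nm (r • M w - M u * A) := by
      have := nm_smul (-1 : k) (r • M w - M u * A)
      simpa using! this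
    rw [this]
    gcongr
  have e3 : nm (M g) / (2 * C) ≤ nm (r • M (g * w)) := by
    have h4 : nm (M g) / C ≤ nm (r • M (g * w)) + d * (nm (M g) * (1 / (2 * C * d))) := by
      rw [div_le_iff₀ hC]
      calc _ ≤ _ := h
        _ ≤ C * (nm (r • M (g * w)) + d * (nm (M g) * (1 / (2 * C * d)))) := by
          gcongr; exact e1.trans e2
        _ = _ := by ring
    have h5 : d * (nm (M g) * (1 / (2 * C * d))) = nm (M g) / (2 * C) := by field_simp
    have h6 : nm (M g) / C = nm (M g) / (2 * C) + nm (M g) / (2 * C) := by field_simp; ring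
    linarith
  have e4 : m2 (r • M (g * w)) ≤ d * (d * (2 * nm (M g) ^ 2 * (η / (8 * d ^ 2 * C ^ 2)))) := by
    have : r • M (g * w) = M g * (r • M w) := by rw [M_mul]; simp
    rw [this]
    refine (m2_mul _ _).trans ?_
    have := m2_le (M g)
    have := m2_nonneg (r • M w)
    gcongr
  rw [m2_smul] at e4
  rw [nm_smul] at e3
  unfold D
  rw [div_le_iff₀ (by positivity)]
  have e5 : ‖r‖ ^ 2 * m2 (M (g * w)) ≤ ‖r‖ ^ 2 * (η * nm (M (g * w)) ^ 2) := by
    calc ‖r‖ ^ 2 * m2 (M (g * w)) ≤ _ := e4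
      _ = η * (nm (M g) / (2 * C)) ^ 2 := by field_simp; ring
      _ ≤ η * (‖r‖ * nm (M (g * w))) ^ 2 := by gcongr
      _ = _ := by ring
  exact le_of_mul_le_mul_left e5 (by positivity)

lemma D_reach (μ : Measure (SLgp d k)) [IsProbabilityMeasure μ]
    (hirr : StronglyIrred (GammaMu μ)) (hcon : ContractingSet (GammaMu μ)) {η : ℝ} (hη : 0 < η) :
    ∃ p : ℝ≥0∞, 0 < p ∧ ∃ L, ∀ g, ∃ n ≤ L, p ≤ It μ n (ind {h : SLgp d k | D h ≤ η}) g := by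
  classical
  have hdp : (0:ℝ) < d := dpos
  obtain ⟨γ, r, φ, A, hγ, -, -, hlim, hA⟩ := hcon
  obtain ⟨hm2, j, hj⟩ := rank_one_col A hA
  obtain ⟨F, C, hF, hC, hgood⟩ := exists_good (GammaMu μ) _
    (orbit_span μ hirr (γ 0) (hγ 0) (A *ᵥ Pi.single j 1) hj)
  have hloc : ∀ u ∈ F, ∃ n, ∃ p : ℝ≥0∞, 0 < p ∧ ∀ g : SLgp d k,
      nm (M g) ≤ C * ‖M g *ᵥ (M u *ᵥ (A *ᵥ Pi.single j 1))‖ →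
      p ≤ It μ n (ind {h : SLgp d k | D h ≤ η}) g := by
    intro u hu
    have hlim2 : Tendsto (fun n => M u * (r (φ n) • M (γ (φ n)))) atTop (nhds (M u * A)) :=
      ((Continuous.matrix_mul continuous_const continuous_id).tendsto A).comp hlim
    have c1 : Tendsto (fun n => nm (M u * (r (φ n) • M (γ (φ n))) - M u * A)) atTop (nhds 0) := by
      have := (continuous_nm.tendsto _).comp (hlim2.sub_const (M u * A))
      have h0 : nm (M u * A - M u * A) = 0 := by
        rw [sub_self]; exact le_antisymm (nm_le le_rfl fun i j => by simp) (nm_nonneg _)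
      rwa [h0] at this
    have c2 : Tendsto (fun n => m2 (M u * (r (φ n) • M (γ (φ n))))) atTop (nhds 0) := by
      have := (continuous_m2.tendsto _).comp hlim2
      have h0 : m2 (M u * A) = 0 := by
        refine le_antisymm ((m2_mul _ _).trans ?_) (m2_nonneg _)
        rw [hm2]; simp
      rwa [h0] at this
    have hA0 : 0 < nm A := by
      rcases (nm_nonneg A).lt_or_eq with h | h
      · exact h
      · exfalso
        have h0 := nm_eq_zero h.symm
        rw [h0, Matrix.zero_mulVec] at hj
        exact hj rfl
    have c3 : Tendsto (fun n => nm (r (φ n) • M (γ (φ n)))) atTop (nhds (nm A)) :=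
      (continuous_nm.tendsto _).comp hlim
    obtain ⟨n, ⟨h1, h2⟩, h3⟩ := ((c1.eventually_lt_const
      (show (0:ℝ) < 1 / (2 * C * d) by positivity)).and
      (c2.eventually_lt_const (show (0:ℝ) < η / (8 * d ^ 2 * C ^ 2) by positivity)) |>.and
      (c3.eventually_const_lt hA0)).exists
    have hr : r (φ n) ≠ 0 := by
      intro h
      rw [h, nm_smul, norm_zero, zero_mul] at h3
      exact lt_irrefl _ h3
    have hMu : M u * (r (φ n) • M (γ (φ n))) = r (φ n) • M (u * γ (φ n)) := by
      rw [M_mul]; simp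
    rw [hMu] at h1 h2
    let U : Set (SLgp d k) := {w | nm (r (φ n) • M w - M u * A) < 1 / (2 * C * d)} ∩
      {w | m2 (r (φ n) • M w) < η / (8 * d ^ 2 * C ^ 2)}
    have hcs : Continuous fun w : SLgp d k => r (φ n) • M w := continuous_M.const_smul (r (φ n))
    have hU : IsOpen U := by
      refine IsOpen.inter (isOpen_lt ?_ continuous_const) (isOpen_lt ?_ continuous_const)
      · exact continuous_nm.comp (hcs.sub continuous_const)
      · exact continuous_m2.comp hcs
    obtain ⟨m, hm⟩ := gamma_reach μ (u * γ (φ n)) (gamma_mul μ (hF hu) (hγ _)) U hU ⟨h1, h2⟩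
    refine ⟨m, It μ m (ind U) 1, pos_iff_ne_zero.2 hm, fun g hg => ?_⟩
    have h4 : It μ m (ind U) 1 ≤ It μ m (fun x => ind {h : SLgp d k | D h ≤ η} (g * x)) 1 := by
      refine It_mono μ (fun x => ?_) m 1
      by_cases hx : x ∈ U
      · have : g * x ∈ {h : SLgp d k | D h ≤ η} := D_good hC hη hg hr (le_of_lt hx.1) (le_of_lt hx.2)
        unfold ind
        rw [if_pos hx, if_pos this]
      · simp [ind, hx]
    rwa [It_translate, mul_one] at h4
  choose! n p hp h using hloc
  obtain ⟨u0, hu0, -⟩ := hgood 1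
  refine ⟨F.inf' ⟨u0, hu0⟩ p, ?_, F.sup n, fun g => ?_⟩
  · exact (Finset.lt_inf'_iff (show F.Nonempty from ⟨u0, hu0⟩)).2 hp
  · obtain ⟨u, hu, hg⟩ := hgood g
    exact ⟨n u, Finset.le_sup hu, (Finset.inf'_le _ hu).trans (h u hu g hg)⟩

theorem D_small (μ : Measure (SLgp d k)) [IsProbabilityMeasure μ]
    (m : Measure (Fin d → k)) (hm : Stat μ m)
    (hirr : StronglyIrred (GammaMu μ)) (hcon : ContractingSet (GammaMu μ)) {η : ℝ} (hη : 0 < η)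
    (ε : ℝ≥0∞) (hε : 0 < ε) :
    ∃ n0, ∀ n ≥ n0, ∀ g, It μ n (ind {h : SLgp d k | η < D h}) g ≤ ε := by
  have hdp : (0:ℝ) < d := dpos
  obtain ⟨κ, hκ, hψ⟩ := psi_norm μ m hm hirr (ε/2) (ENNReal.half_pos hε.ne')
  set e := η * κ ^ 2 / (2 * d ^ 2) with he
  have he0 : 0 < e := by positivity
  obtain ⟨p, hp, L, hL⟩ := D_reach μ hirr hcon he0
  set A := {h : SLgp d k | D h ≤ e} with hA
  have hAm : MeasurableSet A := measurableSet_le measurable_D measurable_const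
  have hq : ∀ g, Sv μ A L g ≤ 1 - p := by
    intro g
    obtain ⟨n, hn, hpn⟩ := hL g
    have h1 : It μ n (ind A) g + It μ n (ind Aᶜ) g = 1 := by
      rw [← It_add μ (measurable_ind hAm)]
      have : (fun x => ind A x + ind Aᶜ x) = fun _ => 1 := by
        funext x; by_cases hx : x ∈ A <;> simp [ind, hx]
      rw [this, It_const]
    calc Sv μ A L g ≤ Sv μ A n g := Sv_antitone μ A g hn
      _ ≤ It μ n (ind Aᶜ) g := Sv_le μ A n g
      _ ≤ 1 - p := by
        refine ENNReal.le_sub_of_add_le_left (ne_top_of_le_ne_top ENNReal.one_ne_top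
          (hpn.trans (It_le_const μ (ind_le_one A) n g))) ?_
        rw [← h1]; gcongr
  have hlt : 1 - p < 1 := ENNReal.sub_lt_self (by simp) (by simp) hp.ne'
  obtain ⟨j, hj⟩ := ((ENNReal.tendsto_pow_atTop_nhds_zero_of_lt_one hlt).eventually_lt_const
    (ENNReal.half_pos hε.ne')).exists
  refine ⟨L * j, fun n hn g => ?_⟩
  have := It_le_Sv μ (A := A) (B := {h : SLgp d k | η < D h}) (a := ε/2) hAm (fun g hg n => ?_) n g
  · refine this.trans ?_
    calc _ ≤ ε/2 + ε/2 := by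
          gcongr
          exact (Sv_antitone μ A g hn).trans ((Sv_pow μ A L _ (by simp) hq j g).trans hj.le)
      _ = ε := ENNReal.add_halves ε
  · refine (It_ind_le_hit μ _ n g).trans (hψ g _ (fun h hh => ?_) n)
    change η < D (g * h) at hh
    change D g ≤ e at hg
    have p1 := nm_pos g; have p2 := nm_pos h; have p3 := nm_pos (g * h)
    have h1 := D_mul_le g h
    have h2 := D_le_two h
    have h3 := D_nonneg h
    have h4 : η * nm (M (g * h)) ^ 2 < η * (κ * (nm (M g) * nm (M h))) ^ 2 := by
      calc η * nm (M (g * h)) ^ 2 < D (g * h) * nm (M (g * h)) ^ 2 := by gcongr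
        _ ≤ _ := h1
        _ ≤ d ^ 2 * (e * 2) * (nm (M g) * nm (M h)) ^ 2 := by gcongr
        _ = _ := by rw [he]; field_simp
    exact lt_of_pow_lt_pow_left₀ 2 (by positivity) (lt_of_mul_lt_mul_left h4 hη.le)

end Contr
end WR

set_option linter.unusedSectionVars false
namespace WR
section Green
variable {k : Type*} [NontriviallyNormedField k] [ProperSpace k]
  [MeasurableSpace k] [BorelSpace k] {d : ℕ} [NeZero d]

lemma It_ind_split (μ : Measure (SLgp d k)) [IsProbabilityMeasure μ] {f : SLgp d k → ℝ≥0∞} {A B : Set (SLgp d k)}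
    (hA : MeasurableSet A) (h : ∀ x, f x ≤ ind A x + ind B x) (n : ℕ) (g : SLgp d k) :
    It μ n f g ≤ It μ n (ind A) g + It μ n (ind B) g := by
  rw [← It_add μ (measurable_ind hA)]
  exact It_mono μ h n g

lemma measurableSet_nmlt (g : SLgp d k) (κ : ℝ) :
    MeasurableSet {h : SLgp d k | nm (M (g * h)) < κ * (nm (M g) * nm (M h))} :=
  measurableSet_lt (measurable_nmM.comp (measurable_const_mul g))
    ((measurable_nmM.const_mul _).const_mul _)

lemma psi_norm_It (μ : Measure (SLgp d k)) [IsProbabilityMeasure μ] {κ : ℝ} {ε : ℝ≥0∞}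
    (hψ : ∀ (g : SLgp d k) (B : Set (SLgp d k)),
      (∀ h, g * h ∈ B → nm (M (g * h)) < κ * (nm (M g) * nm (M h))) → ∀ n,
      Rew μ B (fun _ => 1) n g ≤ ε) (g : SLgp d k) (n : ℕ) :
    It μ n (ind {h : SLgp d k | nm (M (g * h)) < κ * (nm (M g) * nm (M h))}) 1 ≤ ε := by
  have h1 := hψ g {b | nm (M b) < κ * (nm (M g) * nm (M (g⁻¹ * b)))} (fun h hh => by
    have h2 : nm (M (g * h)) < κ * (nm (M g) * nm (M (g⁻¹ * (g * h)))) := hh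
    rwa [inv_mul_cancel_left] at h2) n
  refine le_trans ?_ h1
  refine le_trans ?_ (It_ind_le_hit μ _ n g)
  have h3 := It_translate μ (ind {b : SLgp d k | nm (M b) < κ * (nm (M g) * nm (M (g⁻¹ * b)))}) g n 1
  rw [mul_one] at h3
  rw [← h3]
  refine It_mono μ (fun x => ?_) n 1
  by_cases hx : x ∈ {h : SLgp d k | nm (M (g * h)) < κ * (nm (M g) * nm (M h))}
  · have : g * x ∈ {b : SLgp d k | nm (M b) < κ * (nm (M g) * nm (M (g⁻¹ * b)))} := by
      change nm (M (g * x)) < κ * (nm (M g) * nm (M (g⁻¹ * (g * x))))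
      rw [inv_mul_cancel_left]; exact hx
    unfold ind
    rw [if_pos hx, if_pos this]
  · unfold ind; rw [if_neg hx]; exact zero_le

lemma exists_return (μ : Measure (SLgp d k)) [IsProbabilityMeasure μ]
    (m : Measure (Fin d → k)) (hm : Stat μ m)
    (hirr : StronglyIrred (GammaMu μ)) (hcon : ContractingSet (GammaMu μ)) :
    ∃ n0 : ℕ, ∀ (g : SLgp d k) (E : Set (SLgp d k)), 0 < D g → (∀ h ∈ E, D g / 2 < D h) →
      ∀ n, It μ n0 (Rew μ E (fun _ => 1) n) g ≤ 1 / 2 := by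
  have hdp : (0:ℝ) < d := dpos
  obtain ⟨κ, hκ, hψ⟩ := psi_norm μ m hm hirr (1/8) (by simp)
  set e := κ ^ 2 / (4 * d ^ 2) with he
  have he0 : 0 < e := by positivity
  obtain ⟨n0, hn0⟩ := D_small μ m hm hirr hcon (η := e * κ ^ 2 / d ^ 2) (by positivity) (1/8) (by simp)
  refine ⟨n0, fun g E hg hE n => ?_⟩
  have s1 : ∀ g' : SLgp d k, D g' ≤ e * D g → Rew μ E (fun _ => 1) n g' ≤ 1/8 := by
    intro g' hg'
    refine hψ g' E (fun h hh => ?_) n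
    have h0 := hE _ hh
    have p1 := nm_pos g'; have p2 := nm_pos h; have p3 := nm_pos (g' * h)
    have h1 := D_mul_le g' h
    have h2 := D_le_two h
    have h3 := D_nonneg h
    have h4 : D g / 2 * nm (M (g' * h)) ^ 2 < D g / 2 * (κ * (nm (M g') * nm (M h))) ^ 2 := by
      calc D g / 2 * nm (M (g' * h)) ^ 2 < D (g' * h) * nm (M (g' * h)) ^ 2 := by gcongr
        _ ≤ _ := h1
        _ ≤ d ^ 2 * (e * D g * 2) * (nm (M g') * nm (M h)) ^ 2 := by gcongr
        _ = _ := by rw [he]; field_simp; try ring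
    exact lt_of_pow_lt_pow_left₀ 2 (by positivity) (lt_of_mul_lt_mul_left h4 (by positivity))
  have s2 : It μ n0 (ind {h : SLgp d k | e * D g < D h}) g ≤ 1/8 + 1/8 := by
    have h3 := It_translate μ (ind {h : SLgp d k | e * D g < D h}) g n0 1
    rw [mul_one] at h3
    rw [← h3]
    refine (It_ind_split μ (measurableSet_nmlt g κ)
      (B := {h : SLgp d k | e * κ ^ 2 / d ^ 2 < D h}) (fun x => ?_) n0 1).trans
      (add_le_add (psi_norm_It μ hψ g n0) (hn0 n0 le_rfl 1))
    by_cases h1 : g * x ∈ {h : SLgp d k | e * D g < D h}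
    · by_cases h2 : x ∈ {h : SLgp d k | nm (M (g * h)) < κ * (nm (M g) * nm (M h))}
      · unfold ind; rw [if_pos h1, if_pos h2]; exact le_self_add
      · have h4 : x ∈ {h : SLgp d k | e * κ ^ 2 / d ^ 2 < D h} := by
          change e * D g < D (g * x) at h1
          change ¬ (nm (M (g * x)) < κ * (nm (M g) * nm (M x))) at h2
          rw [not_lt] at h2
          change e * κ ^ 2 / d ^ 2 < D x
          have p1 := nm_pos g; have p2 := nm_pos x; have p3 := nm_pos (g * x)
          have h5 := D_mul_le g x
          have h6 : (D g * (nm (M g) * nm (M x)) ^ 2) * (e * κ ^ 2) <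
              (D g * (nm (M g) * nm (M x)) ^ 2) * (D x * d ^ 2) := by
            calc _ = e * D g * (κ * (nm (M g) * nm (M x))) ^ 2 := by ring
              _ ≤ e * D g * nm (M (g * x)) ^ 2 := by gcongr
              _ < D (g * x) * nm (M (g * x)) ^ 2 := by gcongr
              _ ≤ _ := h5
              _ = _ := by ring
          rw [div_lt_iff₀ (by positivity)]
          exact lt_of_mul_lt_mul_left h6 (by positivity)
        unfold ind; rw [if_pos h1, if_pos h4]; exact le_add_self
    · unfold ind; rw [if_neg h1]; exact zero_le
  have s3 : ∀ x, Rew μ E (fun _ => 1) n x ≤ ind {h : SLgp d k | e * D g < D h} x + 1/8 := by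
    intro x
    by_cases hx : x ∈ {h : SLgp d k | e * D g < D h}
    · refine (hit_le_one μ E n x).trans ?_
      unfold ind; rw [if_pos hx]; exact le_self_add
    · refine (s1 x (not_lt.1 hx)).trans le_add_self
  have s4 := It_mono μ s3 n0 g
  rw [It_add μ (measurable_ind (measurableSet_lt measurable_const measurable_D)), It_const] at s4
  refine s4.trans ((add_le_add s2 le_rfl).trans ?_)
  have : (1/8 + 1/8 + 1/8 : ℝ≥0∞) = ENNReal.ofReal (3/8) := by
    rw [show (3/8:ℝ) = 1/8+1/8+1/8 by norm_num, ENNReal.ofReal_add (by norm_num) (by norm_num),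
      ENNReal.ofReal_add (by norm_num) (by norm_num)]
    have : ENNReal.ofReal (1/8) = 1/8 := by
      rw [ENNReal.ofReal_div_of_pos (by norm_num)]; simp
    rw [this]
  rw [this, show (1/2:ℝ≥0∞) = ENNReal.ofReal (1/2) by
    rw [ENNReal.ofReal_div_of_pos (by norm_num)]; simp]
  exact ENNReal.ofReal_le_ofReal (by norm_num)

/-- dyadic levels -/
def Elev (d : ℕ) (k : Type*) [NontriviallyNormedField k] (j : ℕ) : Set (SLgp d k) :=
  {g | (1/2 : ℝ) ^ j < D g ∧ D g ≤ 2 * (1/2 : ℝ) ^ j}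

lemma exists_level {t : ℝ} (h0 : 0 < t) (h2 : t ≤ 2) :
    ∃ j : ℕ, (1/2 : ℝ) ^ j < t ∧ t ≤ 2 * (1/2 : ℝ) ^ j := by
  have hex : ∃ j : ℕ, (1/2 : ℝ) ^ j < t := exists_pow_lt_of_lt_one h0 (by norm_num)
  classical
  refine ⟨Nat.find hex, Nat.find_spec hex, ?_⟩
  rcases Nat.eq_zero_or_pos (Nat.find hex) with h | h
  · rw [h]; simpa using h2
  · have := Nat.find_min hex (m := Nat.find hex - 1) (by omega)
    rw [not_lt] at this
    calc t ≤ _ := this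
      _ = 2 * (1/2 : ℝ) ^ (Nat.find hex) := by
        conv_rhs => rw [show Nat.find hex = (Nat.find hex - 1) + 1 by omega, pow_succ]
        ring

theorem green_D (μ : Measure (SLgp d k)) [IsProbabilityMeasure μ]
    (m : Measure (Fin d → k)) (hm : Stat μ m)
    (hirr : StronglyIrred (GammaMu μ)) (hcon : ContractingSet (GammaMu μ)) {s : ℝ} (hs : 0 < s) :
    ∃ B : ℝ≥0∞, B ≠ ⊤ ∧ ∀ n, ∑ i ∈ Finset.range n,
      It μ i (fun g => ENNReal.ofReal (D g ^ s)) 1 ≤ B := by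
  obtain ⟨n0, hn0⟩ := exists_return μ m hm hirr hcon
  have hEm : ∀ j, MeasurableSet (Elev d k j) := fun j =>
    (measurableSet_lt measurable_const measurable_D).inter (measurableSet_le measurable_D measurable_const)
  have hG : ∀ j n, Gr μ (Elev d k j) n 1 ≤ 2 * n0 := by
    intro j n
    refine green_bound μ (hEm j) n0 (fun g hg n => ?_) n 1
    have hpj : (0:ℝ) < (1/2) ^ j := by positivity
    refine hn0 g _ (hpj.trans hg.1) (fun h hh => ?_) n
    have h1 := hg.2
    have h2 := hh.1
    linarith
  let a : ℕ → ℝ≥0∞ := fun j => ENNReal.ofReal ((2 * (1/2 : ℝ) ^ j) ^ s)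
  have ha : ∀ j, a j = ENNReal.ofReal (2 ^ s) * ENNReal.ofReal ((1/2 : ℝ) ^ s) ^ j := by
    intro j
    simp only [a]
    rw [Real.mul_rpow (by norm_num) (by positivity), ENNReal.ofReal_mul (by positivity),
      ← ENNReal.ofReal_pow (by positivity), ← Real.rpow_natCast, ← Real.rpow_natCast,
      ← Real.rpow_mul (by norm_num), ← Real.rpow_mul (by norm_num), mul_comm (j:ℝ)]
  have hsum : ∑' j, a j ≠ ⊤ := by
    simp_rw [ha]
    rw [ENNReal.tsum_mul_left, ENNReal.tsum_geometric]
    refine ENNReal.mul_ne_top ENNReal.ofReal_ne_top ?_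
    rw [ENNReal.inv_ne_top]
    have : ENNReal.ofReal ((1/2 : ℝ) ^ s) < 1 := by
      rw [← ENNReal.ofReal_one]
      exact (ENNReal.ofReal_lt_ofReal_iff zero_lt_one).2
        (Real.rpow_lt_one (by norm_num) (by norm_num) hs)
    exact (tsub_pos_of_lt this).ne'
  refine ⟨(∑' j, a j) * (2 * n0), ENNReal.mul_ne_top hsum (ENNReal.mul_ne_top (by simp) (by simp)), fun n => ?_⟩
  have hpt : ∀ g : SLgp d k, ENNReal.ofReal (D g ^ s) ≤ ∑' j, a j * ind (Elev d k j) g := by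
    intro g
    rcases (D_nonneg g).lt_or_eq with h | h
    · obtain ⟨j, hj1, hj2⟩ := exists_level h (D_le_two g)
      refine le_trans ?_ (ENNReal.le_tsum j)
      have : g ∈ Elev d k j := ⟨hj1, hj2⟩
      unfold ind
      rw [if_pos this, mul_one]
      exact ENNReal.ofReal_le_ofReal (Real.rpow_le_rpow h.le hj2 hs.le)
    · rw [← h, Real.zero_rpow hs.ne']; simp
  have hIt : ∀ i, It μ i (fun g => ENNReal.ofReal (D g ^ s)) 1 ≤ ∑' j, a j * It μ i (ind (Elev d k j)) 1 := by
    intro i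
    refine (It_mono μ hpt i 1).trans ?_
    rw [It_tsum μ (fun j => (measurable_ind (hEm j)).const_mul _)]
    refine ENNReal.tsum_le_tsum fun j => ?_
    rw [It_const_mul μ _ _ ENNReal.ofReal_ne_top]
  calc _ ≤ ∑ i ∈ Finset.range n, ∑' j, a j * It μ i (ind (Elev d k j)) 1 :=
        Finset.sum_le_sum fun i _ => hIt i
    _ = ∑' j, ∑ i ∈ Finset.range n, a j * It μ i (ind (Elev d k j)) 1 :=
        (Summable.tsum_finsetSum fun _ _ => ENNReal.summable).symm
    _ ≤ ∑' j, a j * (2 * n0) := by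
        refine ENNReal.tsum_le_tsum fun j => ?_
        rw [← Finset.mul_sum]
        gcongr
        exact hG j n
    _ = _ := ENNReal.tsum_mul_right

end Green
end WR

set_option linter.unusedSectionVars false
namespace WR
section Moments
variable {k : Type*} [NontriviallyNormedField k] {d : ℕ}

lemma norm_le_vnorm (x : Fin d → k) : ‖x‖ ≤ vnorm x := by
  have h0 : 0 ≤ vnorm x := by
    unfold vnorm
    split_ifs
    · exact Real.iSup_nonneg fun i => norm_nonneg _
    · exact Real.sqrt_nonneg _
  refine (pi_norm_le_iff_of_nonneg h0).2 fun i => ?_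
  unfold vnorm
  split_ifs
  · exact le_ciSup (f := fun i => ‖x i‖) (Set.finite_range _).bddAbove i
  · refine Real.le_sqrt_of_sq_le ?_
    exact Finset.single_le_sum (f := fun i => ‖x i‖ ^ 2) (fun i _ => by positivity)
      (Finset.mem_univ i)

lemma vnorm_le [NeZero d] (x : Fin d → k) : vnorm x ≤ d * ‖x‖ := by
  have hd : (1:ℝ) ≤ d := by exact_mod_cast Nat.one_le_iff_ne_zero.2 (NeZero.ne d)
  unfold vnorm
  split_ifs
  · refine ciSup_le fun i => (norm_le_pi_norm x i).trans ?_
    nlinarith [norm_nonneg x]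
  · refine Real.sqrt_le_iff.2 ⟨by positivity, ?_⟩
    have : ∑ i, ‖x i‖ ^ 2 ≤ ∑ _i : Fin d, ‖x‖ ^ 2 :=
      Finset.sum_le_sum fun i _ => pow_le_pow_left₀ (norm_nonneg _) (norm_le_pi_norm x i) 2
    refine this.trans ?_
    rw [Finset.sum_const, Finset.card_univ, Fintype.card_fin, nsmul_eq_mul, mul_pow]
    refine mul_le_mul_of_nonneg_right ?_ (by positivity)
    nlinarith

lemma vnorm_single [NeZero d] (j : Fin d) : vnorm (Pi.single j 1 : Fin d → k) = 1 := by
  have h1 := norm_le_vnorm (Pi.single j 1 : Fin d → k)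
  rw [norm_single_one] at h1
  refine le_antisymm ?_ h1
  unfold vnorm
  split_ifs
  · refine ciSup_le fun i => (norm_le_pi_norm _ i).trans ?_
    rw [norm_single_one]
  · rw [Finset.sum_eq_single j]
    · simp
    · intro b _ hb; simp [Pi.single_eq_of_ne hb]
    · simp

lemma nm_le_mnorm [NeZero d] (A : Matrix (Fin d) (Fin d) k) : nm A ≤ mnorm A := by
  have hb : BddAbove ((fun x => vnorm (A.mulVec x)) '' {x : Fin d → k | vnorm x = 1}) := by
    refine ⟨d * (d * (nm A * 1)), ?_⟩
    rintro _ ⟨x, hx, rfl⟩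
    have hx1 : ‖x‖ ≤ 1 := (norm_le_vnorm x).trans (le_of_eq hx)
    refine (vnorm_le _).trans (mul_le_mul_of_nonneg_left ?_ (by positivity))
    refine (mulVec_le A x).trans (mul_le_mul_of_nonneg_left ?_ (by positivity))
    exact mul_le_mul_of_nonneg_left hx1 (nm_nonneg A)
  obtain ⟨i, j, hij⟩ := exists_entry A
  rw [← hij]
  refine le_trans ?_ (le_csSup hb ⟨Pi.single j 1, vnorm_single j, rfl⟩)
  refine le_trans ?_ (norm_le_vnorm _)
  have := norm_le_pi_norm (A *ᵥ Pi.single j 1) i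
  simpa using this

lemma nm_inv_le [NeZero d] (g : SLgp d k) :
    nm (M g⁻¹) ≤ d.factorial * max 1 (nm (M g)) ^ d := by
  refine nm_le (by positivity) fun i j => ?_
  have h1 : M g⁻¹ i j = ((M g).updateRow j (Pi.single i 1)).det := by
    rw [← Matrix.adjugate_apply]
    exact congrFun (congrFun (Matrix.SpecialLinearGroup.coe_inv g) i) j
  rw [h1]
  have h2 := Matrix.det_le (A := (M g).updateRow j (Pi.single i 1))
    (abv := NormedField.toAbsoluteValue k) (x := max 1 (nm (M g))) (fun a b => by
      change ‖(M g).updateRow j (Pi.single i 1) a b‖ ≤ _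
      by_cases haj : a = j
      · subst haj
        rw [Matrix.updateRow_self]
        refine le_max_of_le_left ((norm_le_pi_norm _ b).trans ?_)
        rw [norm_single_one]
      · rw [Matrix.updateRow_ne haj]
        exact le_max_of_le_right (entry_le _ _ _))
  rw [Fintype.card_fin, nsmul_eq_mul] at h2
  exact h2

lemma N_ge_one [NeZero d] (g : SLgp d k) : 1 ≤ N g := by
  have hd : (1:ℝ) ≤ d := by exact_mod_cast Nat.one_le_iff_ne_zero.2 (NeZero.ne d)
  have h := nm_mul (M g) (M g⁻¹)
  rw [← M_mul, mul_inv_cancel, M_one, nm_one] at h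
  unfold N
  have : 0 ≤ nm (M g) * nm (M g⁻¹) := mul_nonneg (nm_nonneg _) (nm_nonneg _)
  nlinarith [mul_nonneg (mul_nonneg (by linarith : (0:ℝ) ≤ d) this) (by linarith : (0:ℝ) ≤ d - 1)]

lemma N_le [NeZero d] (g : SLgp d k) :
    N g ≤ d ^ 2 * d.factorial * max 1 (nm (M g)) ^ (d + 1) := by
  unfold N
  rw [mul_assoc]
  refine mul_le_mul_of_nonneg_left ?_ (by positivity)
  calc nm (M g) * nm (M g⁻¹) ≤ max 1 (nm (M g)) * (d.factorial * max 1 (nm (M g)) ^ d) :=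
        mul_le_mul (le_max_right _ _) (nm_inv_le g) (nm_nonneg _) (by positivity)
    _ = _ := by ring

lemma moment_N [NeZero d] [MeasurableSpace k] (μ : Measure (SLgp d k)) [IsProbabilityMeasure μ]
    (hmom : ExpLocalMoment μ) :
    ∃ s0 : ℝ, 0 < s0 ∧ ∫⁻ h, ENNReal.ofReal ((N h ^ 2) ^ s0) ∂μ ≠ ⊤ := by
  obtain ⟨τ, hτ, hfin⟩ := hmom
  refine ⟨τ / (2 * (d + 1)), by positivity, ?_⟩
  set s0 := τ / (2 * ((d:ℝ) + 1)) with hs0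
  have hs0p : 0 < s0 := by positivity
  set C : ℝ := ((d ^ 2 * d.factorial : ℝ) ^ 2) ^ s0 with hC
  have hCn : 0 ≤ C := by positivity
  have key : ∀ h : SLgp d k, ENNReal.ofReal ((N h ^ 2) ^ s0)
      ≤ ENNReal.ofReal C * (1 + ENNReal.ofReal (mnorm (M h) ^ τ)) := by
    intro h
    have hmx : (0:ℝ) ≤ max 1 (nm (M h)) := by positivity
    have h1 : (N h ^ 2) ^ s0 ≤ C * max 1 (nm (M h)) ^ τ := by
      calc (N h ^ 2) ^ s0 ≤ ((d ^ 2 * d.factorial * max 1 (nm (M h)) ^ (d + 1)) ^ 2) ^ s0 := by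
            refine Real.rpow_le_rpow (by positivity) ?_ hs0p.le
            exact pow_le_pow_left₀ (N_pos h).le (N_le h) 2
        _ = C * max 1 (nm (M h)) ^ τ := by
            rw [mul_pow, Real.mul_rpow (by positivity) (by positivity), ← pow_mul,
              ← Real.rpow_natCast (max 1 (nm (M h))), ← Real.rpow_mul hmx]
            congr 2
            rw [hs0]; push_cast; field_simp
    have h2 : max 1 (nm (M h)) ^ τ ≤ 1 + mnorm (M h) ^ τ := by
      have h3 := nm_le_mnorm (M h)
      have h4 : 0 ≤ mnorm (M h) := (nm_nonneg _).trans h3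
      rcases le_total (nm (M h)) 1 with h5 | h5
      · rw [max_eq_left h5, Real.one_rpow]
        linarith [Real.rpow_nonneg h4 τ]
      · rw [max_eq_right h5]
        linarith [Real.rpow_le_rpow (nm_nonneg _) h3 hτ.le]
    calc ENNReal.ofReal ((N h ^ 2) ^ s0)
        ≤ ENNReal.ofReal (C * (1 + mnorm (M h) ^ τ)) :=
          ENNReal.ofReal_le_ofReal (h1.trans (mul_le_mul_of_nonneg_left h2 hCn))
      _ ≤ _ := by
          rw [ENNReal.ofReal_mul hCn]
          gcongr
          refine ENNReal.ofReal_add_le.trans ?_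
          rw [ENNReal.ofReal_one]
  refine ne_top_of_le_ne_top ?_ (lintegral_mono key)
  rw [lintegral_const_mul' _ _ ENNReal.ofReal_ne_top, lintegral_add_left measurable_const]
  refine ENNReal.mul_ne_top ENNReal.ofReal_ne_top (ENNReal.add_ne_top.2 ⟨by simp, ?_⟩)
  exact hfin.ne

end Moments

section Iter
variable {k : Type*} [NontriviallyNormedField k] [ProperSpace k]
  [MeasurableSpace k] [BorelSpace k] {d : ℕ} [NeZero d]

/-- the reward function `R_c^{-s}` -/
noncomputable def F (c : Fin d → k) (s : ℝ) (g : SLgp d k) : ℝ≥0∞ := ENNReal.ofReal ((R c g)⁻¹ ^ s)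

lemma measurable_F (c : Fin d → k) (s : ℝ) : Measurable (F c s : SLgp d k → ℝ≥0∞) :=
  ENNReal.measurable_ofReal.comp (((measurable_R c).inv).pow_const s)

lemma F_one {c : Fin d → k} (hc : c ≠ 0) (s : ℝ) : F c s (1 : SLgp d k) = 1 := by
  simp [F, R_one hc]

lemma F_le_of {c : Fin d → k} (hc : c ≠ 0) {s θ : ℝ} (hs : 0 ≤ s) (hθ : 0 < θ) {g : SLgp d k}
    (h : θ ≤ R c g) : F c s g ≤ ENNReal.ofReal (θ⁻¹ ^ s) := by
  refine ENNReal.ofReal_le_ofReal (Real.rpow_le_rpow (inv_nonneg.2 (R_pos hc g).le) ?_ hs)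
  exact inv_anti₀ hθ h

lemma overshoot (μ : Measure (SLgp d k)) [IsProbabilityMeasure μ] (m : Measure (Fin d → k))
    (hm : Stat μ m) (hirr : StronglyIrred (GammaMu μ)) (hcon : ContractingSet (GammaMu μ))
    {s0 η : ℝ} (hs0 : 0 < s0) (hη : 0 < η) (hη1 : η ≤ 1)
    (hmo : ∫⁻ h, ENNReal.ofReal ((N h ^ 2) ^ s0) ∂μ ≠ ⊤) :
    ∃ B : ℝ≥0∞, B ≠ ⊤ ∧ ∀ c : Fin d → k, c ≠ 0 → ∀ n, Rew μ {h | R c h < η} (F c s0) n 1 ≤ B := by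
  obtain ⟨B0, hB0, hG⟩ := green_D μ m hm hirr hcon hs0
  have hd : (1:ℝ) ≤ d := by exact_mod_cast Nat.one_le_iff_ne_zero.2 (NeZero.ne d)
  have hd0 : (0:ℝ) < d := by linarith
  set θ : ℝ := η / (2 * d) with hθ
  have hθ0 : 0 < θ := by positivity
  have hθ1 : θ ≤ 1 := by
    rw [hθ, div_le_one (by positivity)]; linarith
  set K0 : ℝ := 2 * d ^ 3 / η ^ 2 with hK0
  have hK0p : 0 < K0 := by positivity
  set K : ℝ≥0∞ := ENNReal.ofReal (K0 ^ s0) * ∫⁻ h, ENNReal.ofReal ((N h ^ 2) ^ s0) ∂μ with hK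
  have hKt : K ≠ ⊤ := ENNReal.mul_ne_top ENNReal.ofReal_ne_top hmo
  refine ⟨ENNReal.ofReal (θ⁻¹ ^ s0) + 0 + K * B0,
    ENNReal.add_ne_top.2 ⟨by simp, ENNReal.mul_ne_top hKt hB0⟩, fun c hc n => ?_⟩
  set f1 : SLgp d k → ℝ≥0∞ := Set.indicator {g | R c g < θ} (F c s0) with hf1
  have hS : MeasurableSet {g : SLgp d k | R c g < θ} :=
    measurableSet_lt (measurable_R c) measurable_const
  have hf1m : Measurable f1 := (measurable_F c s0).indicator hS
  have h11 : f1 1 = 0 := by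
    rw [hf1, Set.indicator_of_notMem]
    change ¬ (R c 1 < θ)
    rw [R_one hc]; linarith
  have hw : Measurable fun g : SLgp d k => ENNReal.ofReal (D g ^ s0) :=
    ENNReal.measurable_ofReal.comp (measurable_D.pow_const s0)
  have main := Rew_overshoot μ (A := {h | R c h < η}) (f := F c s0) (f1 := f1)
    (w := fun g => ENNReal.ofReal (D g ^ s0)) (b := ENNReal.ofReal (θ⁻¹ ^ s0)) (K := K)
    hKt hw hf1m (fun g _ => ?_) (fun g hg => ?_) n 1
  · refine main.trans ?_
    rw [h11]
    gcongr
    exact hG n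
  · by_cases h : R c g < θ
    · rw [hf1, Set.indicator_of_mem (by exact h)]
      exact le_add_self
    · exact (F_le_of hc hs0.le hθ0 (not_lt.1 h)).trans le_self_add
  · have hg' : η ≤ R c g := not_lt.1 hg
    have pt : ∀ h : SLgp d k, f1 (g * h)
        ≤ (ENNReal.ofReal (K0 ^ s0) * ENNReal.ofReal (D g ^ s0)) *
          ENNReal.ofReal ((N h ^ 2) ^ s0) := by
      intro h
      by_cases hh : R c (g * h) < θ
      · rw [hf1, Set.indicator_of_mem (by exact hh)]
        have hR := R_pos hc (g * h)
        have hN := N_pos h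
        have hD := D_nonneg g
        have e1 := R_drop hc g h
        have e2 := R_mul_ge_N hc g h
        have e3 : d * R c (g * h) ≤ η / 2 := by
          have : d * R c (g * h) ≤ d * θ := mul_le_mul_of_nonneg_left hh.le hd0.le
          have h5 : d * θ = η / 2 := by rw [hθ]; field_simp
          linarith
        have e4 : η ≤ 2 * d ^ 3 * (D g * N h) := by nlinarith
        have e5 : (R c (g * h))⁻¹ ≤ K0 * D g * N h ^ 2 := by
          rw [inv_le_iff_one_le_mul₀ hR]
          have : K0 * D g * N h ^ 2 * R c (g * h)
              = (2 * d ^ 3 * (D g * N h) / η) * ((R c (g * h) * N h) / η) := by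
            rw [hK0]; field_simp
          rw [this]
          have a1 : 1 ≤ 2 * d ^ 3 * (D g * N h) / η := (one_le_div hη).2 e4
          have a2 : 1 ≤ (R c (g * h) * N h) / η := (one_le_div hη).2 (hg'.trans e2)
          exact one_le_mul_of_one_le_of_one_le a1 a2
        rw [← ENNReal.ofReal_mul (by positivity), ← ENNReal.ofReal_mul (by positivity),
          ← Real.mul_rpow (by positivity) hD, ← Real.mul_rpow (by positivity) (by positivity)]
        exact ENNReal.ofReal_le_ofReal
          (Real.rpow_le_rpow (inv_nonneg.2 hR.le) e5 hs0.le)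
      · rw [hf1, Set.indicator_of_notMem (by exact hh)]
        exact bot_le
    calc Pop μ f1 g = ∫⁻ h, f1 (g * h) ∂μ := rfl
      _ ≤ _ := lintegral_mono pt
      _ = K * ENNReal.ofReal (D g ^ s0) := by
        rw [lintegral_const_mul' _ _ (ENNReal.mul_ne_top ENNReal.ofReal_ne_top
          ENNReal.ofReal_ne_top), hK]
        ring

lemma interp_real {x J s s0 : ℝ} (hx : 0 < x) (hJ : 0 < J) (hs : 0 ≤ s) (hss : s ≤ s0) :
    x ^ s ≤ J ^ s + J ^ (s - s0) * x ^ s0 := by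
  rcases le_total x J with h | h
  · have := Real.rpow_le_rpow hx.le h hs
    have h2 : 0 ≤ J ^ (s - s0) * x ^ s0 := by positivity
    linarith
  · have h1 : x ^ (s - s0) ≤ J ^ (s - s0) :=
      Real.rpow_le_rpow_of_nonpos hJ h (by linarith)
    have h2 : x ^ s = x ^ (s - s0) * x ^ s0 := by
      rw [← Real.rpow_add hx]; congr 1; ring
    rw [h2]
    have h3 : 0 ≤ J ^ s := by positivity
    have := mul_le_mul_of_nonneg_right h1 (Real.rpow_nonneg hx.le s0)
    linarith

lemma exists_small_exp {a s1 : ℝ} (ha : 1 < a) (hs1 : 0 < s1) :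
    ∃ s, 0 < s ∧ s ≤ s1 ∧ a ^ s ≤ 2 := by
  have hl : 0 < Real.log a := Real.log_pos ha
  have h2 : 0 < Real.log 2 := Real.log_pos (by norm_num)
  refine ⟨min s1 (Real.log 2 / Real.log a), lt_min hs1 (div_pos h2 hl), min_le_left _ _, ?_⟩
  calc a ^ (min s1 (Real.log 2 / Real.log a)) ≤ a ^ (Real.log 2 / Real.log a) :=
        Real.rpow_le_rpow_of_exponent_le ha.le (min_le_right _ _)
    _ = 2 := by
        rw [Real.rpow_def_of_pos (by linarith), mul_div_cancel₀ _ hl.ne', Real.exp_log (by norm_num)]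

theorem F_bounded (μ : Measure (SLgp d k)) [IsProbabilityMeasure μ] (m : Measure (Fin d → k))
    (hm : Stat μ m) (hirr : StronglyIrred (GammaMu μ)) (hcon : ContractingSet (GammaMu μ))
    (hmom : ExpLocalMoment μ) :
    ∃ s : ℝ, 0 < s ∧ ∃ C : ℝ≥0∞, C ≠ ⊤ ∧ ∀ c : Fin d → k, c ≠ 0 → ∀ n, It μ n (F c s) 1 ≤ C := by
  obtain ⟨s0, hs0, hmo⟩ := moment_N μ hmom
  have hd : (1:ℝ) ≤ d := by exact_mod_cast Nat.one_le_iff_ne_zero.2 (NeZero.ne d)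
  obtain ⟨η, hη, hψ⟩ := psi_small μ m hm hirr (ENNReal.ofReal (1/8)) (by simp)
  have hη1 : η ≤ 1 := by
    by_contra hcon1
    have hc : (Pi.single 0 1 : Fin d → k) ≠ 0 := by
      intro h0
      have := norm_single_one (k := k) (0 : Fin d)
      rw [h0, norm_zero] at this
      exact zero_ne_one this
    have h1 := hψ _ hc 0
    have h2 : (1 : SLgp d k) ∈ {h : SLgp d k | R (Pi.single 0 1 : Fin d → k) h < η} := by
      change R (Pi.single 0 1 : Fin d → k) 1 < η
      rw [R_one hc]; exact not_le.1 hcon1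
    unfold Rew at h1
    rw [if_pos h2, ← ENNReal.ofReal_one, ENNReal.ofReal_le_ofReal_iff (by norm_num)] at h1
    norm_num at h1
  obtain ⟨B, hB, hRew⟩ := overshoot μ m hm hirr hcon hs0 hη hη1 hmo
  set b := B.toReal with hb
  have hb0 : 0 ≤ b := ENNReal.toReal_nonneg
  have hBb : B = ENNReal.ofReal b := (ENNReal.ofReal_toReal hB).symm
  set J : ℝ := (8 * (b + 1)) ^ (2 / s0) with hJdef
  have hJ1 : 1 ≤ J := Real.one_le_rpow (by linarith) (by positivity)
  have hJ0 : 0 < J := by linarith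
  have hJe : J ^ (-(s0 / 2)) = (8 * (b + 1))⁻¹ := by
    rw [hJdef, ← Real.rpow_mul (by positivity)]
    have : 2 / s0 * -(s0 / 2) = -1 := by field_simp
    rw [this, Real.rpow_neg_one]
  obtain ⟨s, hs, hss, hsa⟩ := exists_small_exp (a := J + d) (s1 := s0 / 2) (by linarith) (by positivity)
  have hJs : J ^ s ≤ 2 := (Real.rpow_le_rpow hJ0.le (by linarith) hs.le).trans hsa
  have hds : (d:ℝ) ^ s ≤ 2 := (Real.rpow_le_rpow (by linarith) (by linarith) hs.le).trans hsa
  -- reward bound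
  have hR1 : ∀ c : Fin d → k, c ≠ 0 → ∀ n,
      ENNReal.ofReal ((d:ℝ) ^ s) * Rew μ {h | R c h < η} (F c s) n 1 ≤ ENNReal.ofReal (3/4) := by
    intro c hc n
    have h1 := Rew_interp μ (A := {h : SLgp d k | R c h < η})
      (measurableSet_lt (measurable_R c) measurable_const) (f := F c s) (f' := F c s0)
      (J := ENNReal.ofReal (J ^ s)) (e := ENNReal.ofReal (J ^ (s - s0)))
      ENNReal.ofReal_ne_top ENNReal.ofReal_ne_top (fun g => by
        unfold F
        rw [mul_one, ← ENNReal.ofReal_mul (by positivity),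
          ← ENNReal.ofReal_add (by positivity)
            (mul_nonneg (by positivity) (Real.rpow_nonneg (inv_nonneg.2 (R_pos hc g).le) _))]
        exact ENNReal.ofReal_le_ofReal
          (interp_real (inv_pos.2 (R_pos hc g)) hJ0 hs.le (by linarith))) n 1
    have h2 : ENNReal.ofReal (J ^ (s - s0)) * B ≤ ENNReal.ofReal (1/8) := by
      rw [hBb, ← ENNReal.ofReal_mul (by positivity)]
      refine ENNReal.ofReal_le_ofReal ?_
      have h3 : J ^ (s - s0) ≤ J ^ (-(s0 / 2)) :=
        Real.rpow_le_rpow_of_exponent_le hJ1 (by linarith)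
      rw [hJe] at h3
      calc J ^ (s - s0) * b ≤ (8 * (b + 1))⁻¹ * b := mul_le_mul_of_nonneg_right h3 hb0
        _ ≤ 1 / 8 := by
          rw [inv_mul_le_iff₀ (by positivity)]; linarith
    calc ENNReal.ofReal ((d:ℝ) ^ s) * Rew μ {h | R c h < η} (F c s) n 1
        ≤ ENNReal.ofReal 2 * (ENNReal.ofReal 2 * ENNReal.ofReal (1/8) + ENNReal.ofReal (1/8)) := by
          refine mul_le_mul' (ENNReal.ofReal_le_ofReal hds) (h1.trans (add_le_add ?_ ?_))
          · exact mul_le_mul' (ENNReal.ofReal_le_ofReal hJs) (hψ c hc n)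
          · exact (mul_le_mul' le_rfl (hRew c hc n)).trans h2
      _ ≤ ENNReal.ofReal (3/4) := by
          rw [← ENNReal.ofReal_mul (by norm_num), ← ENNReal.ofReal_add (by norm_num) (by norm_num),
            ← ENNReal.ofReal_mul (by norm_num)]
          exact ENNReal.ofReal_le_ofReal (by norm_num)
  -- growth bound
  set K : ℝ≥0∞ := max 1 (∫⁻ h, ENNReal.ofReal ((N h ^ 2) ^ s0) ∂μ) with hK
  have hKt : K ≠ ⊤ := by
    rw [hK]; exact (max_lt ENNReal.one_lt_top hmo.lt_top).ne
  have hgrow : ∀ c : Fin d → k, c ≠ 0 → ∀ n, It μ n (F c s) 1 ≤ K ^ n := by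
    intro c hc n
    have h1 := It_growth μ (f := F c s) hKt (fun g => ?_) n 1
    · rwa [F_one hc, mul_one] at h1
    · have pt : ∀ h : SLgp d k, F c s (g * h) ≤ F c s g * ENNReal.ofReal ((N h ^ 2) ^ s0) := by
        intro h
        unfold F
        have hR := R_pos hc (g * h)
        have hRg := R_pos hc g
        have hN := N_ge_one h
        have hN0 := N_pos h
        have hi : (0:ℝ) ≤ (R c g)⁻¹ := inv_nonneg.2 hRg.le
        rw [← ENNReal.ofReal_mul (Real.rpow_nonneg hi _)]
        refine ENNReal.ofReal_le_ofReal ?_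
        have h2 : (R c (g * h))⁻¹ ≤ (R c g)⁻¹ * N h := by
          rw [inv_mul_eq_div, le_div_iff₀ hRg, inv_mul_le_iff₀ hR]
          exact R_mul_ge_N hc g h
        refine (Real.rpow_le_rpow (inv_nonneg.2 hR.le) h2 hs.le).trans ?_
        rw [Real.mul_rpow hi hN0.le]
        refine mul_le_mul_of_nonneg_left ?_ (Real.rpow_nonneg hi _)
        refine (Real.rpow_le_rpow hN0.le (by nlinarith : N h ≤ N h ^ 2) hs.le).trans ?_
        exact Real.rpow_le_rpow_of_exponent_le (by nlinarith) (by linarith)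
      calc Pop μ (F c s) g = ∫⁻ h, F c s (g * h) ∂μ := rfl
        _ ≤ _ := lintegral_mono pt
        _ = F c s g * ∫⁻ h, ENNReal.ofReal ((N h ^ 2) ^ s0) ∂μ :=
          lintegral_const_mul' _ _ ENNReal.ofReal_ne_top
        _ ≤ K * F c s g := by
          rw [mul_comm]; exact mul_le_mul' (le_max_right _ _) le_rfl
  have hb1 : ENNReal.ofReal (η⁻¹ ^ s) ≠ ⊤ := ENNReal.ofReal_ne_top
  refine ⟨s, hs, 4 * ENNReal.ofReal (η⁻¹ ^ s), ENNReal.mul_ne_top (by simp) hb1, ?_⟩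
  set b1 := ENNReal.ofReal (η⁻¹ ^ s) with hb1d
  intro c0 hc0 n
  set a : ℝ≥0∞ := ⨆ (c : {c : Fin d → k // c ≠ 0}) (j : Fin (n + 1)), It μ j (F c.1 s) 1 with ha
  have hat : a ≠ ⊤ := by
    refine ne_top_of_le_ne_top (ENNReal.pow_ne_top hKt (n := n)) ?_
    refine iSup_le fun c => iSup_le fun j => (hgrow c.1 c.2 j).trans ?_
    exact pow_le_pow_right₀ (le_max_left _ _) (Nat.lt_succ_iff.1 j.2)
  have hale : ∀ c : Fin d → k, c ≠ 0 → ∀ j ≤ n, It μ j (F c s) 1 ≤ a := fun c hc j hj =>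
    le_iSup_of_le (f := fun c : {c : Fin d → k // c ≠ 0} => _) ⟨c, hc⟩
      (le_iSup (fun j : Fin (n + 1) => It μ j (F c s) 1) ⟨j, Nat.lt_succ_iff.2 hj⟩)
  have hstep : a ≤ b1 + a * ENNReal.ofReal (3/4) := by
    refine iSup_le fun c => iSup_le fun j => ?_
    obtain ⟨c, hc⟩ := c
    obtain ⟨j, hj⟩ := j
    have hj : j ≤ n := Nat.lt_succ_iff.1 hj
    change It μ j (F c s) 1 ≤ _
    have h1 := It_le_Rew μ (A := {h : SLgp d k | R c h < η}) (f := F c s) (b := b1)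
      (a := a * ENNReal.ofReal ((d:ℝ) ^ s)) j (ENNReal.mul_ne_top hat ENNReal.ofReal_ne_top)
      (fun g _ l hl => ?_) (fun g hg => F_le_of hc hs.le hη (not_lt.1 hg)) 1
    · refine h1.trans (add_le_add le_rfl ?_)
      rw [mul_assoc]
      exact mul_le_mul' le_rfl (hR1 c hc j)
    · have h2 := It_translate μ (F c s) g l 1
      rw [mul_one] at h2
      rw [← h2]
      have hcg := vecMul_ne c hc g
      have pt : ∀ x : SLgp d k, F c s (g * x)
          ≤ (ENNReal.ofReal ((d:ℝ) ^ s) * F c s g) * F (c ᵥ* M g) s x := by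
        intro x
        have r1 := R_pos hc g
        have r2 := R_pos hcg x
        have r3 := R_pos hc (g * x)
        have i1 := inv_nonneg.2 r1.le
        have i2 := inv_nonneg.2 r2.le
        unfold F
        rw [← ENNReal.ofReal_mul (by positivity),
          ← ENNReal.ofReal_mul (mul_nonneg (by positivity) (Real.rpow_nonneg i1 _)),
          ← Real.mul_rpow (by linarith) i1,
          ← Real.mul_rpow (mul_nonneg (by linarith) i1) i2]
        refine ENNReal.ofReal_le_ofReal (Real.rpow_le_rpow (inv_nonneg.2 r3.le) ?_ hs.le)
        rw [inv_le_iff_one_le_mul₀ r3]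
        have : d * (R c g)⁻¹ * (R (c ᵥ* M g) x)⁻¹ * R c (g * x)
          = (d * R c (g * x)) / (R c g * R (c ᵥ* M g) x) := by field_simp
        rw [this, one_le_div (mul_pos r1 r2)]
        exact R_mul_ge_R hc g x
      refine (It_mono μ pt l 1).trans ?_
      have hft : ENNReal.ofReal ((d:ℝ) ^ s) * F c s g ≠ ⊤ :=
        ENNReal.mul_ne_top ENNReal.ofReal_ne_top ENNReal.ofReal_ne_top
      rw [It_const_mul μ _ _ hft]
      calc _ ≤ (ENNReal.ofReal ((d:ℝ) ^ s) * F c s g) * a :=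
            mul_le_mul' le_rfl (hale _ hcg l (hl.trans hj))
        _ = _ := by ring
  refine (hale c0 hc0 n le_rfl).trans ?_
  have hsplit : a = a * ENNReal.ofReal (1/4) + a * ENNReal.ofReal (3/4) := by
    rw [← mul_add, ← ENNReal.ofReal_add (by norm_num) (by norm_num)]
    norm_num
  have h5 : a * ENNReal.ofReal (1/4) ≤ b1 := by
    refine (ENNReal.add_le_add_iff_right (ENNReal.mul_ne_top hat
      (ENNReal.ofReal_ne_top (r := 3/4)))).1 ?_
    rw [← hsplit]; exact hstep
  calc a = 4 * (a * ENNReal.ofReal (1/4)) := by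
        rw [mul_left_comm]
        have : (4:ℝ≥0∞) * ENNReal.ofReal (1/4) = 1 := by
          have : (4:ℝ≥0∞) = ENNReal.ofReal 4 := by simp
          rw [this, ← ENNReal.ofReal_mul (by norm_num)]; norm_num
        rw [this, mul_one]
    _ ≤ 4 * b1 := mul_le_mul' le_rfl h5

end Iter
end WR

set_option linter.unusedSectionVars false
namespace WR
section Concl
variable {k : Type*} [NontriviallyNormedField k] [ProperSpace k]
  [MeasurableSpace k] [BorelSpace k] {d : ℕ} [NeZero d]

theorem m_bound (μ : Measure (SLgp d k)) [IsProbabilityMeasure μ] (m : Measure (Fin d → k))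
    (hm : Stat μ m) (hirr : StronglyIrred (GammaMu μ)) (hcon : ContractingSet (GammaMu μ))
    (hmom : ExpLocalMoment μ) :
    ∃ s : ℝ, 0 < s ∧ ∃ C : ℝ, 0 ≤ C ∧ ∀ c : Fin d → k, c ≠ 0 → ∀ ε : ℝ, 0 < ε →
      m (Nb c ε) ≤ ENNReal.ofReal ((2 * d * ε) ^ s * C) := by
  obtain ⟨s, hs, C, hC, hF⟩ := F_bounded μ m hm hirr hcon hmom
  have hd0 : (0:ℝ) < d := dpos
  have hpr := hm.prob
  refine ⟨s, hs, C.toReal, ENNReal.toReal_nonneg, fun c hc ε hε => ?_⟩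
  rw [ENNReal.ofReal_mul (by positivity), ENNReal.ofReal_toReal hC]
  refine ENNReal.le_of_forall_pos_le_add fun e he _ => ?_
  have he2 : (0:ℝ≥0∞) < (e:ℝ≥0∞) / 2 := ENNReal.half_pos (by exact_mod_cast he.ne')
  obtain ⟨κ, hκ, hκm⟩ := phi_small μ m hm hirr _ he2
  obtain ⟨n, hn⟩ := D_small μ m hm hirr hcon (η := ε * κ / d ^ 2) (by positivity) _ he2
  have h1 := It_stat μ m hm (closed_Nb c ε).measurableSet (homog_Nb c ε) n 1
  have hone : {x : Fin d → k | M (1 : SLgp d k) *ᵥ x ∈ Nb c ε} = Nb c ε := by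
    ext x
    change M (1 : SLgp d k) *ᵥ x ∈ Nb c ε ↔ _
    rw [M_one, Matrix.one_mulVec]
  rw [hone] at h1
  rw [← h1]
  have hDm : MeasurableSet {h : SLgp d k | ε * κ / d ^ 2 < D h} :=
    measurableSet_lt measurable_const measurable_D
  have pt : ∀ g : SLgp d k, m {x | M g *ᵥ x ∈ Nb c ε}
      ≤ ENNReal.ofReal ((2 * d * ε) ^ s) * F c s g +
        (ind {h : SLgp d k | ε * κ / d ^ 2 < D h} g + (e:ℝ≥0∞) / 2) := by
    intro g
    by_cases hD : ε * κ / d ^ 2 < D g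
    · have : ind {h : SLgp d k | ε * κ / d ^ 2 < D h} g = 1 := by
        unfold ind; exact if_pos hD
      rw [this]
      exact prob_le_one.trans (le_self_add.trans le_add_self)
    · have hRp := R_pos hc g
      by_cases hR : R c g ≤ 2 * d * ε
      · refine le_trans (prob_le_one.trans ?_) le_self_add
        unfold F
        rw [← ENNReal.ofReal_mul (by positivity), ← Real.mul_rpow (by positivity)
          (inv_nonneg.2 hRp.le), ← ENNReal.ofReal_one]
        refine ENNReal.ofReal_le_ofReal (Real.one_le_rpow ?_ hs.le)
        rw [← div_eq_mul_inv, one_le_div hRp]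
        exact hR
      · obtain ⟨c', hc', -, -, hc2⟩ := mem_row_Nb g
        refine le_trans ?_ (le_add_self.trans le_add_self)
        refine le_trans (measure_mono fun x hx => ?_) (hκm c' hc')
        refine hc2 κ x ?_
        by_contra hlt
        have hlt := not_le.1 hlt
        have hx : ‖c ⬝ᵥ (M g *ᵥ x)‖ ≤ ε * (‖c‖ * ‖M g *ᵥ x‖) := hx
        have hc0 := norm_pos_iff.2 hc
        have hnm := nm_pos g
        have hgx : 0 < ‖M g *ᵥ x‖ := lt_of_le_of_lt (by positivity) hlt
        have hcmp := R_compare hc g x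
        have hDg := D_nonneg g
        apply hR
        have e1 : ‖c ⬝ᵥ (M g *ᵥ x)‖ / ‖c‖ ≤ ε * ‖M g *ᵥ x‖ := by
          rw [div_le_iff₀ hc0]; linarith
        have e2 : d ^ 3 * (D g * nm (M g) * ‖x‖) ≤ d * ε * ‖M g *ᵥ x‖ := by
          have hD' : D g * d ^ 2 ≤ ε * κ := by
            rw [← le_div_iff₀ (by positivity)]; exact not_lt.1 hD
          calc d ^ 3 * (D g * nm (M g) * ‖x‖) = d * (D g * d ^ 2) * (nm (M g) * ‖x‖) := by ring
            _ ≤ d * (ε * κ) * (nm (M g) * ‖x‖) := by gcongr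
            _ = d * ε * (κ * (nm (M g) * ‖x‖)) := by ring
            _ ≤ d * ε * ‖M g *ᵥ x‖ := by gcongr
        refine le_of_mul_le_mul_right ?_ hgx
        have e3 := mul_le_mul_of_nonneg_left e1 hd0.le
        linarith
  refine (It_mono μ pt n 1).trans ?_
  rw [It_add μ ((measurable_F c s).const_mul _), It_add μ (measurable_ind hDm),
    It_const_mul μ _ _ ENNReal.ofReal_ne_top, It_const]
  refine add_le_add (mul_le_mul' le_rfl (hF c hc n)) ?_
  calc _ ≤ (e:ℝ≥0∞) / 2 + (e:ℝ≥0∞) / 2 := add_le_add (hn n le_rfl 1) le_rfl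
    _ = e := ENNReal.add_halves _

lemma pdelta_mem (p : Projectivization k (Fin d → k)) {c : Fin d → k} (hc : c ≠ 0) {r : ℝ}
    (hr : 0 ≤ r) (h : pdeltaH p c ≤ r) : sec p ∈ Nb c (d ^ 2 * r) := by
  rw [sec_mem_rep (homog_Nb _ _), mem_Nb]
  unfold pdeltaH pdistH at h
  have c0 := norm_pos_iff.2 hc
  have x0 := norm_pos_iff.2 p.rep_nonzero
  have c1 := c0.trans_le (norm_le_vnorm c)
  have x1 := x0.trans_le (norm_le_vnorm p.rep)
  rw [div_le_iff₀ (mul_pos c1 x1)] at h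
  calc ‖c ⬝ᵥ p.rep‖ ≤ r * (vnorm c * vnorm p.rep) := h
    _ ≤ r * ((d * ‖c‖) * (d * ‖p.rep‖)) := by
      refine mul_le_mul_of_nonneg_left ?_ hr
      exact mul_le_mul (vnorm_le c) (vnorm_le _) x1.le (by positivity)
    _ = _ := by ring

theorem main (μ : Measure (SLgp d k)) [IsProbabilityMeasure μ]
    (hmom : ExpLocalMoment μ) (hirr : StronglyIrred (GammaMu μ)) (hcon : ContractingSet (GammaMu μ))
    (ν : Measure (Projectivization k (Fin d → k))) [IsProbabilityMeasure ν]
    (hν : InvariantMeasure μ pact ν)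
    {Ω : Type*} [MeasurableSpace Ω] (P : Measure Ω)
    (Z : Ω → Projectivization k (Fin d → k)) (hZ : Measure.map Z P = ν) (t : ℝ) (ht : 0 < t)
    (ht1 : t < 1) :
    ∃ ρ : ℝ, 0 ≤ ρ ∧ ρ < 1 ∧ ∃ N : ℕ, ∀ n : ℕ, N ≤ n →
        ∀ c : Fin d → k, c ≠ 0 →
          P {ω | pdeltaH (Z ω) c ≤ t ^ n} ≤ ENNReal.ofReal (ρ ^ n) := by
  have hd0 : (0:ℝ) < d := dpos
  obtain ⟨s, hs, C, hC, hb⟩ := m_bound μ _ (stat_sec μ ν hν) hirr hcon hmom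
  have hZm : AEMeasurable Z P := by
    by_contra h
    rw [Measure.map_of_not_aemeasurable h] at hZ
    exact IsProbabilityMeasure.ne_zero ν hZ.symm
  set ρ : ℝ := t ^ (s / 2) with hρ
  have hρ0 : 0 ≤ ρ := by positivity
  have hρ1 : ρ < 1 := Real.rpow_lt_one ht.le ht1 (by positivity)
  set C1 : ℝ := (2 * d * d ^ 2) ^ s * C with hC1
  have hlim : Tendsto (fun n : ℕ => C1 * ρ ^ n) atTop (nhds (C1 * 0)) :=
    (tendsto_pow_atTop_nhds_zero_of_lt_one hρ0 hρ1).const_mul C1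
  rw [mul_zero] at hlim
  obtain ⟨N0, hN0⟩ := eventually_atTop.1 (hlim.eventually_le_const (zero_lt_one))
  refine ⟨ρ, hρ0, hρ1, N0, fun n hn c hc => ?_⟩
  have hmeas : MeasurableSet (Nb c (d ^ 2 * t ^ n)) := (closed_Nb _ _).measurableSet
  have h1 : P {ω | pdeltaH (Z ω) c ≤ t ^ n} ≤ (ν.map sec) (Nb c (d ^ 2 * t ^ n)) := by
    rw [Measure.map_apply measurable_sec hmeas, ← hZ,
      Measure.map_apply_of_aemeasurable hZm (measurable_sec hmeas)]
    exact measure_mono fun ω hω => pdelta_mem (Z ω) hc (by positivity) hω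
  refine h1.trans ((hb c hc _ (by positivity)).trans (ENNReal.ofReal_le_ofReal ?_))
  have h2 : (2 * d * (d ^ 2 * t ^ n)) ^ s * C = C1 * ρ ^ n * ρ ^ n := by
    have e1 : (2 * d * (d ^ 2 * t ^ n) : ℝ) = (2 * d * d ^ 2) * t ^ n := by ring
    have e2 : (t ^ n) ^ s = ρ ^ n * ρ ^ n := by
      rw [← mul_pow, hρ, ← Real.rpow_add ht, add_halves, ← Real.rpow_natCast t n,
        ← Real.rpow_mul ht.le, mul_comm (n:ℝ) s, Real.rpow_mul ht.le, Real.rpow_natCast]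
    rw [e1, Real.mul_rpow (by positivity) (by positivity), e2, hC1]
    ring
  rw [h2]
  calc C1 * ρ ^ n * ρ ^ n ≤ 1 * ρ ^ n :=
        mul_le_mul_of_nonneg_right (hN0 n hn) (by positivity)
    _ = ρ ^ n := one_mul _

end Concl
end WR

/-- weak regularity of the invariant measure: uniformly over
projective hyperplanes `H`, `P(δ(Z, H) ≤ t^n)` decays exponentially. -/
theorem statement_13
    {k : Type*} [NontriviallyNormedField k] [CompleteSpace k] [LocallyCompactSpace k]
    [MeasurableSpace k] [BorelSpace k] {d : ℕ} (hd : 2 ≤ d)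
    (μ : Measure (SLgp d k)) [IsProbabilityMeasure μ]
    (hmom : ExpLocalMoment μ)
    (hirr : StronglyIrred (GammaMu μ))
    (hcon : ContractingSet (GammaMu μ))
    -- the unique μ-invariant probability measure ν on P(V)
    (ν : Measure (Projectivization k (Fin d → k))) [IsProbabilityMeasure ν]
    (hν : InvariantMeasure μ pact ν)
    (hνuniq : ∀ ν' : Measure (Projectivization k (Fin d → k)),
      IsProbabilityMeasure ν' → InvariantMeasure μ pact ν' → ν' = ν)
    -- a random variable Z with law ν
    {Ω : Type*} [MeasurableSpace Ω] (P : Measure Ω) [IsProbabilityMeasure P]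
    (Z : Ω → Projectivization k (Fin d → k)) (hZ : Measure.map Z P = ν) :
    ∀ t : ℝ, 0 < t → t < 1 →
      ∃ ρ : ℝ, 0 ≤ ρ ∧ ρ < 1 ∧ ∃ N : ℕ, ∀ n : ℕ, N ≤ n →
        ∀ c : Fin d → k, c ≠ 0 →
          P {ω | pdeltaH (Z ω) c ≤ t ^ n} ≤ ENNReal.ofReal (ρ ^ n) := by
  haveI : ProperSpace k := ProperSpace.of_locallyCompactSpace k
  haveI : NeZero d := ⟨by omega⟩
  intro t ht ht1
  exact WR.main μ hmom hirr hcon ν hν P Z hZ t ht ht1
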